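/- arXiv:1702.03415 — 8 statements merged into one kernel-verified Lean document; each statement's English description precedes it below -/
import Mathlib

section
/- Let λ, μ be real numbers with μ > 0 and 3λ + 2μ > 0. Let x, y ∈ ℝ³ with x ≠ y, let n ∈ ℝ³ be a unit vector, and suppose δ > 0 satisfies |(x−y)·n| ≤ δ|x−y|². Then the 3×3 matrix K₂(x,y) = [μ/(2μ+λ)] ((x−y)·n)/(4π|x−y|³) I + [2(μ+λ)/(2μ+λ)] ((x−y)·n)/(4π|x−y|⁵) (x−y)(x−y)ᵀ satisfies the operator-norm bound ‖K₂(x,y)‖ ≤ δ (μ + 2|μ+λ|)/(4π(2μ+λ)) · |x−y|⁻¹. -/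
open Real
open scoped RealInnerProductSpace

/-- The operator norm of `a I + b r rᵀ` on Euclidean space is at most `|a| + |b| ‖r‖²`. -/
theorem norm_toEuclideanCLM_scalar_add_rankOne_le {ι : Type*} [Fintype ι] [DecidableEq ι]
    (a b : ℝ) (r : EuclideanSpace ℝ ι) (K : Matrix ι ι ℝ)
    (hK : ∀ i j, K i j = a * (if i = j then 1 else 0) + b * (r i * r j)) :
    ‖Matrix.toEuclideanCLM (𝕜 := ℝ) K‖ ≤ |a| + |b| * ‖r‖ ^ 2 := by
  refine ContinuousLinearMap.opNorm_le_bound _ (by positivity) fun v => ?_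
  have happly : Matrix.toEuclideanCLM (𝕜 := ℝ) K v = a • v + (b * ⟪r, v⟫) • r := by
    ext i
    simp only [Matrix.ofLp_toEuclideanCLM, Matrix.mulVec, dotProduct, hK, PiLp.add_apply,
      PiLp.smul_apply, smul_eq_mul, PiLp.inner_apply, add_mul, Finset.sum_add_distrib,
      mul_ite, ite_mul, mul_one, mul_zero, zero_mul, Finset.sum_ite_eq, Finset.mem_univ, if_true,
      RCLike.inner_apply, conj_trivial, Finset.mul_sum, Finset.sum_mul]
    congr 1
    exact Finset.sum_congr rfl fun j _ => by ring
  rw [happly]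
  calc ‖a • v + (b * ⟪r, v⟫) • r‖ ≤ ‖a • v‖ + ‖(b * ⟪r, v⟫) • r‖ := norm_add_le _ _
    _ = |a| * ‖v‖ + |b| * |⟪r, v⟫| * ‖r‖ := by
      rw [norm_smul, norm_smul, norm_mul, norm_eq_abs, norm_eq_abs, norm_eq_abs]
    _ ≤ |a| * ‖v‖ + |b| * (‖r‖ * ‖v‖) * ‖r‖ := by
      gcongr
      exact abs_real_inner_le_norm r v
    _ = (|a| + |b| * ‖r‖ ^ 2) * ‖v‖ := by ring

/-- the weakly singular bound for the kernel `K₂`: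
`‖K₂(x,y)‖ ≤ δ (μ + 2|μ+λ|) / (4π(2μ+λ)) · |x-y|⁻¹`, in the operator norm
on Euclidean `ℝ³`. -/
theorem statement1 (lam mu : ℝ) (hmu : 0 < mu) (hconv : 0 < 3 * lam + 2 * mu)
    (x y n : EuclideanSpace ℝ (Fin 3)) (hxy : x ≠ y) (hn : ‖n‖ = 1)
    (δ : ℝ) (hδ : 0 < δ) (hflat : |⟪x - y, n⟫| ≤ δ * ‖x - y‖^2)
    (K₂ : Matrix (Fin 3) (Fin 3) ℝ)
    (hK₂ : ∀ i j : Fin 3,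
      K₂ i j = mu / (2*mu+lam) * (⟪x - y, n⟫ / (4 * π * ‖x - y‖^3)) * (if i = j then 1 else 0)
        + 2*(mu+lam) / (2*mu+lam) * (⟪x - y, n⟫ / (4 * π * ‖x - y‖^5)) * ((x - y) i * (x - y) j)) :
    ‖Matrix.toEuclideanCLM (𝕜 := ℝ) K₂‖ ≤ δ * (mu + 2 * |mu + lam|) / (4 * π * (2*mu+lam)) * ‖x - y‖⁻¹ := by
  have hr : 0 < ‖x - y‖ := norm_pos_iff.mpr (sub_ne_zero.mpr hxy)
  have hc : 0 < 2 * mu + lam := by linarith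
  refine (norm_toEuclideanCLM_scalar_add_rankOne_le _ _ (x - y) K₂ hK₂).trans ?_
  rw [abs_mul, abs_mul, abs_div, abs_div, abs_div, abs_div, abs_mul 2, abs_of_pos hmu,
    abs_of_pos hc, abs_two, abs_of_pos (by positivity : 0 < 4 * π * ‖x - y‖ ^ 3),
    abs_of_pos (by positivity : 0 < 4 * π * ‖x - y‖ ^ 5)]
  calc mu / (2 * mu + lam) * (|⟪x - y, n⟫| / (4 * π * ‖x - y‖ ^ 3))
        + 2 * |mu + lam| / (2 * mu + lam) * (|⟪x - y, n⟫| / (4 * π * ‖x - y‖ ^ 5)) * ‖x - y‖ ^ 2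
      ≤ mu / (2 * mu + lam) * (δ * ‖x - y‖ ^ 2 / (4 * π * ‖x - y‖ ^ 3))
        + 2 * |mu + lam| / (2 * mu + lam) * (δ * ‖x - y‖ ^ 2 / (4 * π * ‖x - y‖ ^ 5))
          * ‖x - y‖ ^ 2 := by gcongr
    _ = δ * (mu + 2 * |mu + lam|) / (4 * π * (2 * mu + lam)) * ‖x - y‖⁻¹ := by
      field_simp
end

section
/- Let D ⊆ ℝ² be open, let K ⊆ D be a compact convex set, and let Φ : D → ℝ³ be twice continuously differentiable with (∂₁Φ × ∂₂Φ)(u) ≠ 0 for every u ∈ K. Define the unit normal n(u) = (∂₁Φ × ∂₂Φ)(u)/|(∂₁Φ × ∂₂Φ)(u)|. Then there exists a constant C > 0 such that for all u, v ∈ K, |(Φ(u) − Φ(v)) · n(u)| ≤ C |u − v|². -/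
open scoped RealInnerProductSpace

/-- The cross product in Euclidean `ℝ³`. -/
noncomputable def cross3 (p q : EuclideanSpace ℝ (Fin 3)) : EuclideanSpace ℝ (Fin 3) :=
  (WithLp.equiv 2 (Fin 3 → ℝ)).symm
    ![p 1 * q 2 - p 2 * q 1, p 2 * q 0 - p 0 * q 2, p 0 * q 1 - p 1 * q 0]

/-- Second-order Taylor estimate, uniform over a compact convex subset of the domain. -/
theorem exists_norm_sub_sub_fderiv_le_of_contDiffOn_two
    {E F : Type*} [NormedAddCommGroup E] [NormedSpace ℝ E]
    [NormedAddCommGroup F] [NormedSpace ℝ F] {D K : Set E} {f : E → F}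
    (hD : IsOpen D) (hKcpt : IsCompact K) (hKconv : Convex ℝ K) (hKD : K ⊆ D)
    (hf : ContDiffOn ℝ 2 f D) :
    ∃ C > 0, ∀ u ∈ K, ∀ v ∈ K, ‖f v - f u - fderiv ℝ f u (v - u)‖ ≤ C * ‖v - u‖ ^ 2 := by
  have hf' : ContDiffOn ℝ 1 (fderiv ℝ f) D := hf.fderiv_of_isOpen hD (by norm_num)
  have hf'' : ContinuousOn (fderiv ℝ (fderiv ℝ f)) D :=
    hf'.continuousOn_fderiv_of_isOpen hD le_rfl
  obtain ⟨C, hC⟩ :=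
    hKcpt.exists_bound_of_continuousOn (f := fderiv ℝ (fderiv ℝ f)) (hf''.mono hKD)
  refine ⟨max C 1, by positivity, fun u hu v hv => ?_⟩
  have hlip : ∀ x ∈ K, ‖fderiv ℝ f x - fderiv ℝ f u‖ ≤ max C 1 * ‖x - u‖ := fun x hx =>
    hKconv.norm_image_sub_le_of_norm_fderiv_le
      (fun y hy => (hf'.differentiableOn one_ne_zero).differentiableAt (hD.mem_nhds (hKD hy)))
      (fun y hy => (hC y hy).trans (le_max_left _ _)) hu hx
  have hseg : segment ℝ u v ⊆ K := hKconv.segment_subset hu hv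
  calc ‖f v - f u - fderiv ℝ f u (v - u)‖ ≤ max C 1 * ‖v - u‖ * ‖v - u‖ :=
        (convex_segment u v).norm_image_sub_le_of_norm_fderiv_le'
          (fun y hy => (hf.differentiableOn two_ne_zero).differentiableAt
            (hD.mem_nhds (hKD (hseg hy))))
          (fun y hy => (hlip y (hseg hy)).trans (by
            gcongr
            exact norm_sub_le_of_mem_segment hy))
          (left_mem_segment ℝ u v) (right_mem_segment ℝ u v)
    _ = max C 1 * ‖v - u‖ ^ 2 := by ring

theorem inner_cross3_left (p q : EuclideanSpace ℝ (Fin 3)) : ⟪p, cross3 p q⟫ = 0 := by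
  simp [cross3, PiLp.inner_apply, Fin.sum_univ_three]
  ring

theorem inner_cross3_right (p q : EuclideanSpace ℝ (Fin 3)) : ⟪q, cross3 p q⟫ = 0 := by
  simp [cross3, PiLp.inner_apply, Fin.sum_univ_three]
  ring

/-- The cross product of the images of the basis vectors is orthogonal to the range. -/
theorem inner_apply_cross3_single
    (L : EuclideanSpace ℝ (Fin 2) →L[ℝ] EuclideanSpace ℝ (Fin 3))
    (w : EuclideanSpace ℝ (Fin 2)) :
    ⟪L w, cross3 (L (EuclideanSpace.single 0 1)) (L (EuclideanSpace.single 1 1))⟫ = 0 := by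
  have hw : w = w 0 • EuclideanSpace.single 0 (1 : ℝ)
      + w 1 • EuclideanSpace.single 1 (1 : ℝ) := by
    ext i
    fin_cases i <;> simp
  have hL : L w = w 0 • L (EuclideanSpace.single 0 1)
      + w 1 • L (EuclideanSpace.single 1 1) := by
    conv_lhs => rw [hw]
    simp only [map_add, map_smul]
  rw [hL, inner_add_left, real_inner_smul_left, real_inner_smul_left,
    inner_cross3_left, inner_cross3_right, mul_zero, mul_zero, add_zero]

/-- for a `C²` surface parametrization `Φ` with unit normal `n`,
`|(Φ(u) - Φ(v)) · n(u)| ≤ C|u - v|²` on a compact convex subset of the chart. -/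
theorem statement2 (D : Set (EuclideanSpace ℝ (Fin 2))) (hD : IsOpen D)
    (K : Set (EuclideanSpace ℝ (Fin 2))) (hKcpt : IsCompact K) (hKconv : Convex ℝ K)
    (hKD : K ⊆ D)
    (Φ : EuclideanSpace ℝ (Fin 2) → EuclideanSpace ℝ (Fin 3))
    (hΦ : ContDiffOn ℝ 2 Φ D)
    (N : EuclideanSpace ℝ (Fin 2) → EuclideanSpace ℝ (Fin 3))
    (hN : ∀ u, N u = cross3 (fderiv ℝ Φ u (EuclideanSpace.single 0 1))
                            (fderiv ℝ Φ u (EuclideanSpace.single 1 1)))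
    (hN0 : ∀ u ∈ K, N u ≠ 0)
    (n : EuclideanSpace ℝ (Fin 2) → EuclideanSpace ℝ (Fin 3))
    (hn : ∀ u, n u = ‖N u‖⁻¹ • N u) :
    ∃ C > 0, ∀ u ∈ K, ∀ v ∈ K, |⟪Φ u - Φ v, n u⟫| ≤ C * ‖u - v‖^2 := by
  obtain ⟨C, hC, hTaylor⟩ :=
    exists_norm_sub_sub_fderiv_le_of_contDiffOn_two hD hKcpt hKconv hKD hΦ
  refine ⟨C, hC, fun u hu v hv => ?_⟩
  have hnorm : ‖n u‖ = 1 := by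
    rw [hn, norm_smul, norm_inv, norm_norm, inv_mul_cancel₀ (norm_ne_zero_iff.2 (hN0 u hu))]
  have htangent : ⟪fderiv ℝ Φ u (v - u), n u⟫ = 0 := by
    rw [hn, real_inner_smul_right, hN, inner_apply_cross3_single, mul_zero]
  have hinner : ⟪Φ u - Φ v, n u⟫ = -⟪Φ v - Φ u - fderiv ℝ Φ u (v - u), n u⟫ := by
    rw [inner_sub_left _ (fderiv ℝ Φ u (v - u)), htangent, sub_zero, ← inner_neg_left, neg_sub]
  calc |⟪Φ u - Φ v, n u⟫| = |⟪Φ v - Φ u - fderiv ℝ Φ u (v - u), n u⟫| := by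
        rw [hinner, abs_neg]
    _ ≤ ‖Φ v - Φ u - fderiv ℝ Φ u (v - u)‖ * ‖n u‖ := abs_real_inner_le_norm _ _
    _ ≤ C * ‖u - v‖ ^ 2 := by
        rw [hnorm, mul_one, norm_sub_rev u v]
        exact hTaylor u hu v hv
end

section
/- Let D ⊆ ℝ² be open, let K ⊆ D be a compact convex set, and let Φ : D → ℝ³ be three times continuously differentiable. Define G(u) = DΦ(u)ᵀ DΦ(u). Assume there is a constant c > 0 such that |Φ(u) − Φ(v)| ≥ c|u − v| for all u, v ∈ K and ⟨w, G(u)w⟩ ≥ c²|w|² for all u ∈ K and w ∈ ℝ². Then there exists a constant C > 0 such that for all u, v ∈ K with u ≠ v, | |Φ(u) − Φ(v)|⁻³ − ⟨u − v, G(u)(u − v)⟩^(−3/2) | ≤ C |u − v|⁻². -/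
open Matrix
open scoped RealInnerProductSpace

/-- The second order Taylor bound for a `C²` map on a compact convex set. -/
theorem exists_norm_sub_sub_fderiv_le {E F : Type*} [NormedAddCommGroup E] [NormedSpace ℝ E]
    [NormedAddCommGroup F] [NormedSpace ℝ F] {D K : Set E} (hD : IsOpen D) (hKcpt : IsCompact K)
    (hKconv : Convex ℝ K) (hKD : K ⊆ D) {f : E → F} (hf : ContDiffOn ℝ 2 f D) :
    ∃ M ≥ 0, ∀ u ∈ K, ∀ v ∈ K, ‖f u - f v - fderiv ℝ f u (u - v)‖ ≤ M * ‖u - v‖ ^ 2 := by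
  have hf' : ContDiffOn ℝ 1 (fderiv ℝ f) D := hf.fderiv_of_isOpen hD (by norm_num)
  obtain ⟨L, hL⟩ := (hf'.mono hKD).exists_lipschitzOnWith one_ne_zero hKconv hKcpt
  refine ⟨L, L.coe_nonneg, fun u hu v hv => ?_⟩
  have hseg : segment ℝ u v ⊆ K := hKconv.segment_subset hu hv
  have hderiv : ∀ x ∈ segment ℝ u v, HasFDerivWithinAt f (fderiv ℝ f x) (segment ℝ u v) x :=
    fun x hx => ((hf.differentiableOn two_ne_zero).differentiableAt
      (hD.mem_nhds (hKD (hseg hx)))).hasFDerivAt.hasFDerivWithinAt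
  have hbound : ∀ x ∈ segment ℝ u v, ‖fderiv ℝ f x - fderiv ℝ f u‖ ≤ L * ‖u - v‖ := by
    intro x hx
    refine (hL.norm_sub_le (hseg hx) hu).trans ?_
    gcongr
    rw [norm_sub_rev u v]
    exact norm_sub_le_of_mem_segment hx
  have h := (convex_segment u v).norm_image_sub_le_of_norm_hasFDerivWithin_le' hderiv hbound
    (right_mem_segment ℝ u v) (left_mem_segment ℝ u v)
  rwa [mul_assoc, ← pow_two] at h

theorem abs_inv_cube_sub_inv_cube_le {a b m : ℝ} (hm : 0 < m) (ha : m ≤ a) (hb : m ≤ b) :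
    |(a ^ 3)⁻¹ - (b ^ 3)⁻¹| ≤ 3 * |a - b| * (m ^ 4)⁻¹ := by
  have ha0 : 0 < a := hm.trans_le ha
  have hb0 : 0 < b := hm.trans_le hb
  have key : (a ^ 3)⁻¹ - (b ^ 3)⁻¹
      = (b - a) * ((a * b ^ 3)⁻¹ + (a ^ 2 * b ^ 2)⁻¹ + (a ^ 3 * b)⁻¹) := by
    field_simp
    ring
  have h₁ : (a * b ^ 3)⁻¹ ≤ (m * m ^ 3)⁻¹ := by gcongr
  have h₂ : (a ^ 2 * b ^ 2)⁻¹ ≤ (m ^ 2 * m ^ 2)⁻¹ := by gcongr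
  have h₃ : (a ^ 3 * b)⁻¹ ≤ (m ^ 3 * m)⁻¹ := by gcongr
  rw [key, abs_mul, abs_sub_comm b a, abs_of_pos (a := _ + _ + _) (by positivity)]
  calc |a - b| * ((a * b ^ 3)⁻¹ + (a ^ 2 * b ^ 2)⁻¹ + (a ^ 3 * b)⁻¹)
      ≤ |a - b| * ((m * m ^ 3)⁻¹ + (m ^ 2 * m ^ 2)⁻¹ + (m ^ 3 * m)⁻¹) := by gcongr
    _ = 3 * |a - b| * (m ^ 4)⁻¹ := by ring

theorem sum_mul_gram_mul_eq_norm_sq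
    (A : EuclideanSpace ℝ (Fin 2) →L[ℝ] EuclideanSpace ℝ (Fin 3)) (J : Matrix (Fin 3) (Fin 2) ℝ)
    (hJ : ∀ k i, J k i = A (EuclideanSpace.single i 1) k) (w : EuclideanSpace ℝ (Fin 2)) :
    ∑ i : Fin 2, ∑ j : Fin 2, w i * (Jᵀ * J) i j * w j = ‖A w‖ ^ 2 := by
  have hw : w = w 0 • EuclideanSpace.single 0 1 + w 1 • EuclideanSpace.single 1 1 := by
    ext i
    fin_cases i <;> simp
  have hA : ∀ k, A w k = w 0 * J k 0 + w 1 * J k 1 := by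
    intro k
    conv_lhs => rw [hw]
    simp [hJ]
  simp only [EuclideanSpace.real_norm_sq_eq, hA, Matrix.mul_apply, Matrix.transpose_apply,
    Fin.sum_univ_two, Fin.sum_univ_three]
  ring

theorem sq_rpow_neg_three_half {b : ℝ} (hb : 0 ≤ b) : (b ^ 2) ^ (-(3 : ℝ) / 2) = (b ^ 3)⁻¹ := by
  rw [← Real.rpow_natCast b 2, ← Real.rpow_mul hb, ← Real.rpow_natCast b 3, ← Real.rpow_neg hb]
  norm_num

/-- approximation of the singular kernel `|Φ(u)-Φ(v)|⁻³` by
`⟨u-v, G(u)(u-v)⟩^(-3/2)`, with error `O(|u-v|⁻²)`. -/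
theorem statement4 (D : Set (EuclideanSpace ℝ (Fin 2))) (hD : IsOpen D)
    (K : Set (EuclideanSpace ℝ (Fin 2))) (hKcpt : IsCompact K) (hKconv : Convex ℝ K)
    (hKD : K ⊆ D)
    (Φ : EuclideanSpace ℝ (Fin 2) → EuclideanSpace ℝ (Fin 3))
    (hΦ : ContDiffOn ℝ 3 Φ D)
    (DΦ : EuclideanSpace ℝ (Fin 2) → Matrix (Fin 3) (Fin 2) ℝ)
    (hDΦ : ∀ u, ∀ k : Fin 3, ∀ i : Fin 2,
      DΦ u k i = fderiv ℝ Φ u (EuclideanSpace.single i 1) k)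
    (G : EuclideanSpace ℝ (Fin 2) → Matrix (Fin 2) (Fin 2) ℝ)
    (hG : ∀ u, G u = (DΦ u)ᵀ * DΦ u)
    (c : ℝ) (hc : 0 < c)
    (hlow : ∀ u ∈ K, ∀ v ∈ K, c * ‖u - v‖ ≤ ‖Φ u - Φ v‖)
    (hGlow : ∀ u ∈ K, ∀ w : EuclideanSpace ℝ (Fin 2),
      c^2 * ‖w‖^2 ≤ ∑ i : Fin 2, ∑ j : Fin 2, w i * G u i j * w j) :
    ∃ C > 0, ∀ u ∈ K, ∀ v ∈ K, u ≠ v →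
      |(‖Φ u - Φ v‖^3)⁻¹
          - (∑ i : Fin 2, ∑ j : Fin 2, (u - v) i * G u i j * (u - v) j) ^ (-(3:ℝ)/2)|
        ≤ C * (‖u - v‖^2)⁻¹ := by
  obtain ⟨M, hM, hTaylor⟩ := exists_norm_sub_sub_fderiv_le hD hKcpt hKconv hKD
    (hΦ.of_le (by norm_num : (2 : WithTop ℕ∞) ≤ 3))
  have hQ : ∀ u w, ∑ i : Fin 2, ∑ j : Fin 2, w i * G u i j * w j = ‖fderiv ℝ Φ u w‖ ^ 2 := by
    intro u w
    rw [hG]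
    exact sum_mul_gram_mul_eq_norm_sq _ _ (hDΦ u) w
  refine ⟨3 * (M + 1) * (c ^ 4)⁻¹, by positivity, fun u hu v hv huv => ?_⟩
  have hr : 0 < ‖u - v‖ := norm_pos_iff.2 (sub_ne_zero.2 huv)
  have hlow' : c * ‖u - v‖ ≤ ‖fderiv ℝ Φ u (u - v)‖ := by
    refine le_of_sq_le_sq ?_ (norm_nonneg _)
    rw [mul_pow, ← hQ]
    exact hGlow u hu (u - v)
  have hdiff : |‖Φ u - Φ v‖ - ‖fderiv ℝ Φ u (u - v)‖| ≤ (M + 1) * ‖u - v‖ ^ 2 :=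
    ((abs_norm_sub_norm_le _ _).trans (hTaylor u hu v hv)).trans (by gcongr; linarith)
  rw [hQ, sq_rpow_neg_three_half (norm_nonneg _)]
  calc _ ≤ 3 * |‖Φ u - Φ v‖ - ‖fderiv ℝ Φ u (u - v)‖| * ((c * ‖u - v‖) ^ 4)⁻¹ :=
        abs_inv_cube_sub_inv_cube_le (by positivity) (hlow u hu v hv) hlow'
    _ ≤ 3 * ((M + 1) * ‖u - v‖ ^ 2) * ((c * ‖u - v‖) ^ 4)⁻¹ := by gcongr
    _ = 3 * (M + 1) * (c ^ 4)⁻¹ * (‖u - v‖ ^ 2)⁻¹ := by field_simp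
end

section
/- Let G be a real symmetric positive definite 2×2 matrix, let ξ ∈ ℝ² with ξ ≠ 0, and let j ∈ {1,2}. Then the truncated integrals ∫_{ε ≤ |z| ≤ R} zⱼ ⟨z, Gz⟩^(−3/2) e^(−i z·ξ) dz converge, as ε → 0⁺ and R → ∞, to the limit −2πi (G⁻¹ξ)ⱼ / ( √(det G) · ⟨ξ, G⁻¹ξ⟩^(1/2) ). In particular, the symbol of the surface Riesz transform R_j^g with metric tensor G, defined as (1/(2π)) times this principal-value Fourier transform, equals −i (G⁻¹ξ)ⱼ / ( √(det G) · ⟨ξ, G⁻¹ξ⟩^(1/2) ). -/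
open Filter Matrix
open scoped Topology

open MeasureTheory Set

/-- The sine integral `Si`. -/
noncomputable def sineIntegral (x : ℝ) : ℝ := ∫ y in (0 : ℝ)..x, Real.sinc y

lemma continuous_sineIntegral : Continuous sineIntegral :=
  intervalIntegral.continuous_primitive
    (fun _ _ => Real.continuous_sinc.intervalIntegrable _ _) 0

lemma sineIntegral_zero : sineIntegral 0 = 0 := by simp [sineIntegral]

lemma sineIntegral_neg (x : ℝ) : sineIntegral (-x) = -sineIntegral x := by
  have h := intervalIntegral.integral_comp_neg (a := 0) (b := x) Real.sinc
  simp only [Real.sinc_neg, neg_zero] at h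
  rw [sineIntegral, sineIntegral, h, intervalIntegral.integral_symm]

lemma integral_sin_mul_exp_neg (R t : ℝ) :
    ∫ x in (0 : ℝ)..R, Real.sin x * Real.exp (-(x * t)) =
      (1 - Real.exp (-(R * t)) * (Real.cos R + t * Real.sin R)) * (1 + t ^ 2)⁻¹ := by
  have ht : 1 + t ^ 2 ≠ 0 := by positivity
  rw [intervalIntegral.integral_eq_sub_of_hasDerivAt
    (f := fun x => -(Real.exp (-(x * t)) * (Real.cos x + t * Real.sin x)) * (1 + t ^ 2)⁻¹)]
  · simp
    ring
  · intro x _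
    have h1 : HasDerivAt (fun x : ℝ => Real.exp (-(x * t))) (Real.exp (-(x * t)) * (-(1 * t))) x :=
      (((hasDerivAt_id x).mul_const t).neg).exp
    have h2 := (Real.hasDerivAt_cos x).add ((Real.hasDerivAt_sin x).const_mul t)
    refine ((h1.mul h2).neg.mul_const (1 + t ^ 2)⁻¹).congr_deriv ?_
    field_simp
    simp only [Pi.add_apply]
    ring
  · exact (by fun_prop : Continuous fun x => Real.sin x * Real.exp (-(x * t))).intervalIntegrable _ _

lemma integral_exp_neg_mul_Ioi_zero {x : ℝ} (hx : 0 < x) :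
    ∫ t in Ioi (0 : ℝ), Real.exp (-(x * t)) = x⁻¹ := by
  have h := integral_exp_mul_Ioi (a := -x) (by linarith) 0
  simpa [neg_mul, div_eq_mul_inv, inv_neg] using h

lemma integrableOn_exp_neg_mul_Ioi_zero {x : ℝ} (hx : 0 < x) :
    IntegrableOn (fun t => Real.exp (-(x * t))) (Ioi (0 : ℝ)) := by
  simpa [neg_mul] using integrableOn_exp_mul_Ioi (a := -x) (by linarith) 0

lemma sineIntegral_eq_integral_Ioi {R : ℝ} (hR : 0 ≤ R) :
    sineIntegral R = ∫ t in Ioi (0 : ℝ),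
      (1 - Real.exp (-(R * t)) * (Real.cos R + t * Real.sin R)) * (1 + t ^ 2)⁻¹ := by
  have hint : Integrable (Function.uncurry fun x t => Real.sin x * Real.exp (-(x * t)))
      ((volume.restrict (Ioc 0 R)).prod (volume.restrict (Ioi 0))) := by
    rw [integrable_prod_iff]
    · constructor
      · filter_upwards [ae_restrict_mem measurableSet_Ioc] with x hx
        exact (integrableOn_exp_neg_mul_Ioi_zero hx.1).const_mul (Real.sin x)
      · have h : IntegrableOn (fun x => |Real.sinc x|) (Ioc 0 R) :=
          (Real.continuous_sinc.abs.integrableOn_Icc).mono_set Ioc_subset_Icc_self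
        refine h.congr_fun (fun x hx => ?_) measurableSet_Ioc
        simp only [Function.uncurry, norm_mul, Real.norm_eq_abs, Real.abs_exp]
        rw [integral_const_mul, integral_exp_neg_mul_Ioi_zero hx.1,
          Real.sinc_of_ne_zero hx.1.ne', abs_div, abs_of_pos hx.1, div_eq_mul_inv]
    · exact (by fun_prop : Continuous (Function.uncurry
        fun x t : ℝ => Real.sin x * Real.exp (-(x * t)))).aestronglyMeasurable
  calc sineIntegral R
      = ∫ x in Ioc 0 R, ∫ t in Ioi (0 : ℝ), Real.sin x * Real.exp (-(x * t)) := by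
        rw [sineIntegral, intervalIntegral.integral_of_le hR]
        refine setIntegral_congr_fun measurableSet_Ioc fun x hx => ?_
        rw [integral_const_mul, integral_exp_neg_mul_Ioi_zero hx.1,
          Real.sinc_of_ne_zero hx.1.ne', div_eq_mul_inv]
    _ = ∫ t in Ioi (0 : ℝ), ∫ x in Ioc 0 R, Real.sin x * Real.exp (-(x * t)) :=
        integral_integral_swap hint
    _ = _ := by
        refine integral_congr_ae (ae_of_all _ fun t => ?_)
        simp only
        rw [← intervalIntegral.integral_of_le hR, integral_sin_mul_exp_neg]

/-- The Dirichlet integral. -/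
theorem tendsto_sineIntegral_atTop : Tendsto sineIntegral atTop (𝓝 (Real.pi / 2)) := by
  have h : Tendsto (fun R : ℝ => ∫ t in Ioi (0 : ℝ),
      (1 - Real.exp (-(R * t)) * (Real.cos R + t * Real.sin R)) * (1 + t ^ 2)⁻¹) atTop
      (𝓝 (∫ t in Ioi (0 : ℝ), (1 + t ^ 2)⁻¹)) := by
    refine tendsto_integral_filter_of_dominated_convergence (fun t => 2 * (1 + t ^ 2)⁻¹) ?_ ?_ ?_ ?_
    · refine Eventually.of_forall fun R => Continuous.aestronglyMeasurable ?_
      have : ∀ t : ℝ, 1 + t ^ 2 ≠ 0 := fun t => by positivity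
      fun_prop (disch := exact this _)
    · filter_upwards [eventually_ge_atTop 1] with R hR
      filter_upwards [ae_restrict_mem measurableSet_Ioi] with t ht
      have ht : 0 < t := ht
      rw [norm_mul, Real.norm_eq_abs, Real.norm_of_nonneg (by positivity : 0 ≤ (1 + t ^ 2)⁻¹)]
      gcongr
      have h1 : Real.exp (-(R * t)) * (1 + t) ≤ 1 := by
        rw [Real.exp_neg, inv_mul_le_one₀ (Real.exp_pos _)]
        nlinarith [Real.add_one_le_exp (R * t)]
      have h2 : |Real.cos R + t * Real.sin R| ≤ 1 + t := by
        refine (abs_add_le _ _).trans (add_le_add (Real.abs_cos_le_one R) ?_)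
        rw [abs_mul, abs_of_pos ht]
        exact mul_le_of_le_one_right ht.le (Real.abs_sin_le_one R)
      have h3 : |Real.exp (-(R * t)) * (Real.cos R + t * Real.sin R)| ≤ 1 := by
        rw [abs_mul, Real.abs_exp]
        exact (mul_le_mul_of_nonneg_left h2 (Real.exp_pos _).le).trans h1
      rw [abs_le] at h3 ⊢
      constructor <;> linarith
    · exact integrable_inv_one_add_sq.integrableOn.const_mul 2
    · filter_upwards [ae_restrict_mem measurableSet_Ioi] with t ht
      have ht : 0 < t := ht
      have h0 : Tendsto (fun R : ℝ => Real.exp (-(R * t))) atTop (𝓝 0) :=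
        Real.tendsto_exp_neg_atTop_nhds_zero.comp (tendsto_id.atTop_mul_const ht)
      have h1 : Tendsto (fun R : ℝ => Real.exp (-(R * t)) * (Real.cos R + t * Real.sin R)) atTop
          (𝓝 0) := by
        refine h0.zero_mul_isBoundedUnder_le (isBoundedUnder_of ⟨1 + t, fun R => ?_⟩)
        refine (abs_add_le _ _).trans (add_le_add (Real.abs_cos_le_one R) ?_)
        rw [abs_mul, abs_of_pos ht]
        exact mul_le_of_le_one_right ht.le (Real.abs_sin_le_one R)
      simpa using (h1.const_sub 1).mul_const (1 + t ^ 2)⁻¹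
  rw [integral_Ioi_inv_one_add_sq] at h
  simp only [Real.arctan_zero, sub_zero] at h
  refine h.congr' ?_
  filter_upwards [eventually_ge_atTop 0] with R hR
  rw [sineIntegral_eq_integral_Ioi hR]

lemma exists_forall_abs_sineIntegral_le : ∃ M : ℝ, ∀ x, |sineIntegral x| ≤ M := by
  obtain ⟨N, hN⟩ := eventually_atTop.1
    (tendsto_sineIntegral_atTop.abs.eventually_le_const (lt_add_one _))
  obtain ⟨M, hM⟩ := (isCompact_Icc (a := 0) (b := N)).exists_bound_of_continuousOn
    continuous_sineIntegral.continuousOn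
  have key : ∀ x, 0 ≤ x → |sineIntegral x| ≤ max M (|Real.pi / 2| + 1) := fun x hx => by
    rcases le_total x N with h | h
    · exact le_max_of_le_left (hM x ⟨hx, h⟩)
    · exact le_max_of_le_right (hN x h)
  refine ⟨max M (|Real.pi / 2| + 1), fun x => ?_⟩
  rcases le_total 0 x with h | h
  · exact key x h
  · simpa [sineIntegral_neg] using key (-x) (by linarith)

lemma tendsto_sineIntegral_mul_atTop (s : ℝ) :
    Tendsto (fun R => sineIntegral (R * s)) atTop (𝓝 (Real.pi / 2 * SignType.sign s)) := by
  rcases lt_trichotomy s 0 with h | rfl | h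
  · have h1 : Tendsto (fun R => -sineIntegral (R * -s)) atTop (𝓝 (-(Real.pi / 2))) :=
      (tendsto_sineIntegral_atTop.comp (tendsto_id.atTop_mul_const (neg_pos.2 h))).neg
    simpa [sineIntegral_neg, sign_neg h] using h1
  · simp [sineIntegral_zero]
  · simpa [sign_pos h, Function.comp_def] using
      tendsto_sineIntegral_atTop.comp (tendsto_id.atTop_mul_const h)

lemma integral_sin_mul_div {ε R : ℝ} (hε : 0 < ε) (hR : ε ≤ R) (s : ℝ) :
    ∫ r in ε..R, Real.sin (r * s) / r = sineIntegral (R * s) - sineIntegral (ε * s) := by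
  have h : ∫ r in ε..R, Real.sin (r * s) / r = s * ∫ r in ε..R, Real.sinc (r * s) := by
    rw [← intervalIntegral.integral_const_mul]
    refine intervalIntegral.integral_congr fun r hr => ?_
    rw [uIcc_of_le hR] at hr
    have hr0 : r ≠ 0 := (hε.trans_le hr.1).ne'
    rcases eq_or_ne s 0 with rfl | hs
    · simp
    · rw [Real.sinc_of_ne_zero (mul_ne_zero hr0 hs)]
      field_simp
  rw [h, intervalIntegral.mul_integral_comp_mul_right, sineIntegral, sineIntegral,
    intervalIntegral.integral_interval_sub_left] <;>
  exact Real.continuous_sinc.intervalIntegrable _ _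

lemma tendsto_integral_mul_sineIntegral_sub {K s : ℝ → ℝ} (hK : Continuous K) (hs : Continuous s)
    (α β : ℝ) :
    Tendsto (fun p : ℝ × ℝ =>
        ∫ t in α..β, K t * (sineIntegral (p.2 * s t) - sineIntegral (p.1 * s t)))
      (𝓝[>] 0 ×ˢ atTop)
      (𝓝 (∫ t in α..β, K t * (Real.pi / 2 * SignType.sign (s t)))) := by
  obtain ⟨M, hM⟩ := exists_forall_abs_sineIntegral_le
  have hSi := continuous_sineIntegral
  refine intervalIntegral.tendsto_integral_filter_of_dominated_convergence
    (fun t => |K t| * (M + M)) ?_ ?_ ?_ ?_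
  · exact Eventually.of_forall fun p => Continuous.aestronglyMeasurable (by fun_prop)
  · refine Eventually.of_forall fun p => ae_of_all _ fun t _ => ?_
    rw [norm_mul, Real.norm_eq_abs, Real.norm_eq_abs]
    gcongr
    exact (abs_sub _ _).trans (add_le_add (hM _) (hM _))
  · exact (by fun_prop : Continuous fun t => |K t| * (M + M)).intervalIntegrable _ _
  · refine ae_of_all _ fun t _ => Tendsto.const_mul _ ?_
    have h1 := (tendsto_sineIntegral_mul_atTop (s t)).comp
      (tendsto_snd (f := 𝓝[>] (0 : ℝ)) (g := atTop))
    have h2 : Tendsto (fun x => sineIntegral (x * s t)) (𝓝[>] 0) (𝓝 0) := by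
      have h3 : Continuous fun x => sineIntegral (x * s t) := by fun_prop
      simpa [sineIntegral_zero] using (h3.tendsto 0).mono_left nhdsWithin_le_nhds
    simpa using h1.sub (h2.comp (tendsto_fst (f := 𝓝[>] (0 : ℝ)) (g := atTop)))

lemma intervalIntegral_eq_zero_of_antiperiodic {f : ℝ → ℝ} {T : ℝ}
    (hf : Function.Antiperiodic f T) :
    ∫ t in -T..T, f t = 0 := by
  by_cases hint : IntervalIntegrable f volume (-T) T
  · rcases le_total 0 T with hT | hT
    all_goals
    · have h0 : (0 : ℝ) ∈ uIcc (-T) T := by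
        first
        | exact Icc_subset_uIcc ⟨by linarith, hT⟩
        | exact Icc_subset_uIcc' ⟨hT, by linarith⟩
      have h1 := intervalIntegral.integral_add_adjacent_intervals
        (hint.mono_set (uIcc_subset_uIcc_left h0)) (hint.mono_set (uIcc_subset_uIcc_right h0))
      have h2 := intervalIntegral.integral_comp_add_right (a := -T) (b := 0) f T
      simp only [hf _, intervalIntegral.integral_neg, neg_add_cancel, zero_add] at h2
      rw [← h1, ← h2, add_neg_cancel]
  · exact intervalIntegral.integral_undef hint

lemma integral_annulus_sector {K s : ℝ → ℝ} (hK : Continuous K) (hs : Continuous s)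
    (hKa : Function.Antiperiodic K Real.pi) (hsa : Function.Antiperiodic s Real.pi)
    {ε R : ℝ} (hε : 0 < ε) (hR : ε ≤ R) :
    ∫ p in Icc ε R ×ˢ Ioo (-Real.pi) Real.pi, ((K p.2 / p.1 : ℝ) : ℂ) *
        Complex.exp (-Complex.I * ((p.1 * s p.2 : ℝ) : ℂ)) =
      -Complex.I * ((∫ t in -Real.pi..Real.pi,
        K t * (sineIntegral (R * s t) - sineIntegral (ε * s t)) : ℝ) : ℂ) := by
  set S := Icc ε R ×ˢ Ioo (-Real.pi) Real.pi
  have hint : ∀ g : ℝ → ℝ, Continuous g →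
      IntegrableOn (fun p : ℝ × ℝ => K p.2 * (g (p.1 * s p.2) / p.1)) S := by
    intro g hg
    refine IntegrableOn.mono_set (t := Icc ε R ×ˢ Icc (-Real.pi) Real.pi) ?_
      (prod_mono_right Ioo_subset_Icc_self)
    refine ContinuousOn.integrableOn_compact (isCompact_Icc.prod isCompact_Icc) ?_
    have h0 : ∀ p ∈ Icc ε R ×ˢ Icc (-Real.pi) Real.pi, p.1 ≠ 0 :=
      fun p hp => (hε.trans_le hp.1.1).ne'
    fun_prop (disch := assumption)
  have hiter : ∀ g : ℝ → ℝ, Continuous g →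
      ∫ p in S, K p.2 * (g (p.1 * s p.2) / p.1) =
        ∫ t in -Real.pi..Real.pi, K t * ∫ r in ε..R, g (r * s t) / r := by
    intro g hg
    have h := hint g hg
    rw [IntegrableOn, Measure.volume_eq_prod, ← Measure.prod_restrict] at h
    rw [Measure.volume_eq_prod, ← Measure.prod_restrict, integral_prod_symm _ h,
      intervalIntegral.integral_of_le (by linarith [Real.pi_pos]), integral_Ioc_eq_integral_Ioo]
    refine integral_congr_ae (ae_of_all _ fun t => ?_)
    simp only
    rw [integral_const_mul, intervalIntegral.integral_of_le hR, integral_Icc_eq_integral_Ioc]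
  have hcos : ∫ p in S, K p.2 * (Real.cos (p.1 * s p.2) / p.1) = 0 := by
    rw [hiter _ Real.continuous_cos]
    refine intervalIntegral_eq_zero_of_antiperiodic fun t => ?_
    simp only [hKa t, hsa t, mul_neg, Real.cos_neg, neg_mul]
  have hsin := hiter _ Real.continuous_sin
  simp only [integral_sin_mul_div hε hR] at hsin
  calc _ = ∫ p in S, (((K p.2 * (Real.cos (p.1 * s p.2) / p.1) : ℝ) : ℂ) +
        (-Complex.I) * ((K p.2 * (Real.sin (p.1 * s p.2) / p.1) : ℝ) : ℂ)) := by
        refine integral_congr_ae (ae_of_all _ fun p => ?_)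
        simp only
        rw [show -Complex.I * ((p.1 * s p.2 : ℝ) : ℂ) = ((-(p.1 * s p.2) : ℝ) : ℂ) * Complex.I by
          push_cast; ring, Complex.exp_mul_I, ← Complex.ofReal_cos, ← Complex.ofReal_sin,
          Real.cos_neg, Real.sin_neg]
        push_cast
        ring
    _ = _ := by
        rw [integral_add (hint _ Real.continuous_cos).ofReal
          ((hint _ Real.continuous_sin).ofReal.const_mul _), integral_const_mul,
          integral_complex_ofReal, integral_complex_ofReal, hcos, hsin]
        simp

lemma integral_mul_sign_cos {K : ℝ → ℝ} (hK : Continuous K)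
    (hKa : Function.Antiperiodic K Real.pi) (φ : ℝ) :
    ∫ t in -Real.pi..Real.pi, K t * (SignType.sign (Real.cos (t - φ)) : ℝ) =
      2 * ∫ t in (φ - Real.pi / 2)..(φ + Real.pi / 2), K t := by
  set f : ℝ → ℝ := fun t => K t * (SignType.sign (Real.cos (t - φ)) : ℝ) with hf
  have hper : Function.Periodic f Real.pi := fun t => by
    simp only [hf]
    rw [hKa t, show t + Real.pi - φ = t - φ + Real.pi by ring, Real.cos_add_pi,
      Left.sign_neg, SignType.coe_neg, neg_mul_neg]
  have hint : ∀ x y, IntervalIntegrable f volume x y := fun x y => by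
    rw [intervalIntegrable_iff]
    refine Integrable.mul_bdd (c := 1) (hK.intervalIntegrable x y).def' ?_ (ae_of_all _ fun t => ?_)
    · have h1 : Measurable fun t : ℝ => (SignType.sign (Real.cos (t - φ)) : ℝ) := by
        have : (fun t : ℝ => (SignType.sign (Real.cos (t - φ)) : ℝ)) =
            fun t => if 0 < Real.cos (t - φ) then 1 else if Real.cos (t - φ) < 0 then -1 else 0 := by
          ext t
          rw [sign_apply]
          split_ifs <;> simp
        rw [this]
        have hc : Measurable fun t : ℝ => Real.cos (t - φ) := by fun_prop
        exact Measurable.ite (measurableSet_lt measurable_const hc) measurable_const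
          (Measurable.ite (measurableSet_lt hc measurable_const) measurable_const measurable_const)
      exact h1.aestronglyMeasurable
    · rcases lt_trichotomy (Real.cos (t - φ)) 0 with h | h | h
      · simp [sign_neg h]
      · simp [h]
      · simp [sign_pos h]
  have h1 := hper.intervalIntegral_add_eq (-Real.pi) (φ - Real.pi / 2)
  have h2 := hper.intervalIntegral_add_eq 0 (φ - Real.pi / 2)
  rw [neg_add_cancel] at h1
  rw [zero_add] at h2
  rw [show φ - Real.pi / 2 + Real.pi = φ + Real.pi / 2 by ring] at h1 h2
  rw [← intervalIntegral.integral_add_adjacent_intervals (hint _ 0) (hint _ _), h1, h2, ← two_mul]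
  congr 1
  rw [intervalIntegral.integral_of_le (by linarith [Real.pi_pos]),
    intervalIntegral.integral_of_le (by linarith [Real.pi_pos]),
    integral_Ioc_eq_integral_Ioo, integral_Ioc_eq_integral_Ioo]
  refine setIntegral_congr_fun measurableSet_Ioo fun t ht => ?_
  have : 0 < Real.cos (t - φ) :=
    Real.cos_pos_of_mem_Ioo ⟨by linarith [ht.1], by linarith [ht.2]⟩
  simp [hf, sign_pos this]

lemma EuclideanSpace.integral_polarCoord {E : Type*} [NormedAddCommGroup E] [NormedSpace ℝ E]
    (f : EuclideanSpace ℝ (Fin 2) → E) :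
    ∫ z, f z = ∫ p in Ioi (0 : ℝ) ×ˢ Ioo (-Real.pi) Real.pi,
      p.1 • f !₂[p.1 * Real.cos p.2, p.1 * Real.sin p.2] := by
  have h1 := (PiLp.volume_preserving_toLp (Fin 2)).integral_comp
    (MeasurableEquiv.toLp 2 (Fin 2 → ℝ)).measurableEmbedding f
  have h2 := (volume_preserving_finTwoArrow ℝ).symm.integral_comp
    (MeasurableEquiv.finTwoArrow (α := ℝ)).symm.measurableEmbedding (fun x => f (WithLp.toLp 2 x))
  rw [← h1, ← h2, ← integral_comp_polarCoord_symm]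
  rfl

/-- The values on the unit circle of a linear form times the power `-3/2` of a quadratic form. -/
noncomputable def angularKernel (a b d c e t : ℝ) : ℝ :=
  (c * Real.cos t + e * Real.sin t) *
    (a * Real.cos t ^ 2 + 2 * b * Real.cos t * Real.sin t + d * Real.sin t ^ 2) ^ (-(3 : ℝ) / 2)

lemma quadratic_form_pos {a b d : ℝ} (ha : 0 < a) (hD : 0 < a * d - b ^ 2) {x y : ℝ}
    (hxy : x ≠ 0 ∨ y ≠ 0) : 0 < a * x ^ 2 + 2 * b * x * y + d * y ^ 2 := by
  have h : 0 < a * (a * x ^ 2 + 2 * b * x * y + d * y ^ 2) := by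
    rw [show a * (a * x ^ 2 + 2 * b * x * y + d * y ^ 2) =
      (a * x + b * y) ^ 2 + (a * d - b ^ 2) * y ^ 2 by ring]
    rcases eq_or_ne y 0 with rfl | hy
    · have : x ≠ 0 := by simpa using hxy
      simp only [mul_zero, add_zero]
      positivity
    · positivity
  exact pos_of_mul_pos_right h ha.le

lemma quadratic_form_cos_sin_pos {a b d : ℝ} (ha : 0 < a) (hD : 0 < a * d - b ^ 2) (t : ℝ) :
    0 < a * Real.cos t ^ 2 + 2 * b * Real.cos t * Real.sin t + d * Real.sin t ^ 2 := by
  refine quadratic_form_pos ha hD ?_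
  by_contra! h
  have := Real.cos_sq_add_sin_sq t
  simp [h.1, h.2] at this

lemma continuous_angularKernel {a b d : ℝ} (ha : 0 < a) (hD : 0 < a * d - b ^ 2) (c e : ℝ) :
    Continuous (angularKernel a b d c e) := by
  refine Continuous.mul (by fun_prop) (Continuous.rpow_const (by fun_prop) fun t => Or.inl ?_)
  exact (quadratic_form_cos_sin_pos ha hD t).ne'

lemma antiperiodic_angularKernel (a b d c e : ℝ) :
    Function.Antiperiodic (angularKernel a b d c e) Real.pi := fun t => by
  simp only [angularKernel, Real.cos_add_pi, Real.sin_add_pi, neg_sq, mul_neg, neg_mul, neg_neg]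
  ring

/-- An antiderivative of `angularKernel`. -/
noncomputable def angularPrimitive (a b d c e t : ℝ) : ℝ :=
  (c * (d * Real.sin t + b * Real.cos t) - e * (a * Real.cos t + b * Real.sin t)) /
      (a * d - b ^ 2) *
    (a * Real.cos t ^ 2 + 2 * b * Real.cos t * Real.sin t + d * Real.sin t ^ 2) ^ (-(1 : ℝ) / 2)

lemma hasDerivAt_angularPrimitive {a b d : ℝ} (ha : 0 < a) (hD : 0 < a * d - b ^ 2)
    (c e t : ℝ) :
    HasDerivAt (angularPrimitive a b d c e) (angularKernel a b d c e t) t := by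
  have hq := quadratic_form_cos_sin_pos ha hD t
  have hc := Real.hasDerivAt_cos t
  have hs := Real.hasDerivAt_sin t
  have hm := ((((hs.const_mul d).add (hc.const_mul b)).const_mul c).sub
    (((hc.const_mul a).add (hs.const_mul b)).const_mul e)).div_const (a * d - b ^ 2)
  have hQ := (((hc.pow 2).const_mul a).add ((hc.const_mul (2 * b)).mul hs)).add
    ((hs.pow 2).const_mul d)
  have h := hm.mul (hQ.rpow_const (p := -(1 : ℝ) / 2) (Or.inl hq.ne'))
  refine h.congr_deriv ?_
  simp only [Pi.add_apply, Pi.sub_apply, Pi.mul_apply, Pi.pow_apply]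
  have e1 : (-(1 : ℝ) / 2 - 1) = -(3 : ℝ) / 2 := by norm_num
  have e2 := Real.rpow_add_one hq.ne' (-(3 : ℝ) / 2)
  rw [show -(3 : ℝ) / 2 + 1 = -(1 : ℝ) / 2 by norm_num] at e2
  rw [e1, e2, angularKernel]
  have hcs := Real.cos_sq_add_sin_sq t
  generalize (a * Real.cos t ^ 2 + 2 * b * Real.cos t * Real.sin t + d * Real.sin t ^ 2) ^
    (-(3 : ℝ) / 2) = Q
  generalize Real.cos t = C at *
  generalize Real.sin t = S at *
  have hD' := hD.ne'
  generalize hDe : a * d - b ^ 2 = D at hD'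
  field_simp
  push_cast
  linear_combination (2 * Q * (c * C + e * S) * D) * hcs +
    (2 * Q * (c * C + e * S) * (C ^ 2 + S ^ 2)) * hDe

lemma integral_angularKernel_half_circle {a b d : ℝ} (ha : 0 < a) (hD : 0 < a * d - b ^ 2)
    (c e φ : ℝ) {ρ : ℝ} (hρ : 0 < ρ) :
    ∫ t in (φ - Real.pi / 2)..(φ + Real.pi / 2), angularKernel a b d c e t =
      2 * (c * (d * (ρ * Real.cos φ) - b * (ρ * Real.sin φ)) +
          e * (a * (ρ * Real.sin φ) - b * (ρ * Real.cos φ))) /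
        ((a * d - b ^ 2) * √(d * (ρ * Real.cos φ) ^ 2 -
          2 * b * (ρ * Real.cos φ) * (ρ * Real.sin φ) + a * (ρ * Real.sin φ) ^ 2)) := by
  rw [intervalIntegral.integral_eq_sub_of_hasDerivAt
    (fun t _ => hasDerivAt_angularPrimitive ha hD c e t)
    ((continuous_angularKernel ha hD c e).intervalIntegrable _ _)]
  have hq := quadratic_form_cos_sin_pos ha hD (φ + Real.pi / 2)
  simp only [angularPrimitive, Real.cos_add_pi_div_two, Real.sin_add_pi_div_two,
    Real.cos_sub_pi_div_two, Real.sin_sub_pi_div_two] at hq ⊢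
  rw [show d * (ρ * Real.cos φ) ^ 2 - 2 * b * (ρ * Real.cos φ) * (ρ * Real.sin φ) +
      a * (ρ * Real.sin φ) ^ 2 = ρ ^ 2 * (a * (-Real.sin φ) ^ 2 +
        2 * b * (-Real.sin φ) * Real.cos φ + d * Real.cos φ ^ 2) by ring,
    Real.sqrt_mul (sq_nonneg ρ), Real.sqrt_sq hρ.le]
  rw [show a * Real.sin φ ^ 2 + 2 * b * Real.sin φ * -Real.cos φ + d * (-Real.cos φ) ^ 2 =
    a * (-Real.sin φ) ^ 2 + 2 * b * (-Real.sin φ) * Real.cos φ + d * Real.cos φ ^ 2 by ring]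
  generalize a * (-Real.sin φ) ^ 2 + 2 * b * (-Real.sin φ) * Real.cos φ + d * Real.cos φ ^ 2 = Q
    at *
  rw [show -(1 : ℝ) / 2 = -(1 / 2) by norm_num, Real.rpow_neg hq.le, ← Real.sqrt_eq_rpow]
  have h1 := hD.ne'
  have h2 := (Real.sqrt_pos.2 hq).ne'
  field_simp
  ring

lemma integral_annulus_polar {a b d : ℝ} (ha : 0 < a) (hD : 0 < a * d - b ^ 2) (c e u v : ℝ)
    {ε R : ℝ} (hε : 0 < ε) :
    ∫ z in {z : EuclideanSpace ℝ (Fin 2) | ε ≤ ‖z‖ ∧ ‖z‖ ≤ R},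
        (((c * z 0 + e * z 1) *
          (a * z 0 ^ 2 + 2 * b * z 0 * z 1 + d * z 1 ^ 2) ^ (-(3 : ℝ) / 2) : ℝ) : ℂ) *
          Complex.exp (-Complex.I * ((z 0 * u + z 1 * v : ℝ) : ℂ)) =
      ∫ p in Icc ε R ×ˢ Ioo (-Real.pi) Real.pi, ((angularKernel a b d c e p.2 / p.1 : ℝ) : ℂ) *
        Complex.exp (-Complex.I *
          ((p.1 * (Real.cos p.2 * u + Real.sin p.2 * v) : ℝ) : ℂ)) := by
  have hA : MeasurableSet {z : EuclideanSpace ℝ (Fin 2) | ε ≤ ‖z‖ ∧ ‖z‖ ≤ R} :=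
    (measurableSet_le measurable_const measurable_norm).inter
      (measurableSet_le measurable_norm measurable_const)
  rw [← integral_indicator hA, EuclideanSpace.integral_polarCoord]
  have hsub : Icc ε R ×ˢ Ioo (-Real.pi) Real.pi ⊆ Ioi (0 : ℝ) ×ˢ Ioo (-Real.pi) Real.pi :=
    prod_mono_left fun r hr => hε.trans_le hr.1
  rw [← inter_eq_right.2 hsub, ← setIntegral_indicator (measurableSet_Icc.prod measurableSet_Ioo)]
  refine setIntegral_congr_fun (measurableSet_Ioi.prod measurableSet_Ioo) fun p hp => ?_
  obtain ⟨r, t⟩ := p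
  obtain ⟨hr, ht⟩ := hp
  simp only [mem_Ioi] at hr ht
  have hn : ‖(!₂[r * Real.cos t, r * Real.sin t] : EuclideanSpace ℝ (Fin 2))‖ = r := by
    rw [EuclideanSpace.norm_eq, Fin.sum_univ_two]
    simp only [Matrix.cons_val_zero, Matrix.cons_val_one, Real.norm_eq_abs, sq_abs]
    rw [show (r * Real.cos t) ^ 2 + (r * Real.sin t) ^ 2 =
      r ^ 2 * (Real.cos t ^ 2 + Real.sin t ^ 2) by ring, Real.cos_sq_add_sin_sq, mul_one,
      Real.sqrt_sq hr.le]
  by_cases h : ε ≤ r ∧ r ≤ R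
  · rw [indicator_of_mem (by simpa [hn] using h),
      indicator_of_mem (show (r, t) ∈ Icc ε R ×ˢ Ioo (-Real.pi) Real.pi from ⟨h, ht⟩)]
    simp only [Matrix.cons_val_zero, Matrix.cons_val_one]
    have hq := quadratic_form_cos_sin_pos ha hD t
    rw [show a * (r * Real.cos t) ^ 2 + 2 * b * (r * Real.cos t) * (r * Real.sin t) +
      d * (r * Real.sin t) ^ 2 = r ^ 2 * (a * Real.cos t ^ 2 +
        2 * b * Real.cos t * Real.sin t + d * Real.sin t ^ 2) by ring,
      Real.mul_rpow (sq_nonneg r) hq.le, ← Real.rpow_natCast r 2, ← Real.rpow_mul hr.le,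
      show ((2 : ℕ) : ℝ) * (-(3 : ℝ) / 2) = -((3 : ℕ) : ℝ) by norm_num, Real.rpow_neg hr.le,
      Real.rpow_natCast, Complex.real_smul, ← mul_assoc, ← Complex.ofReal_mul]
    congr 2
    · rw [angularKernel]
      field_simp
    · ring_nf
  · rw [indicator_of_notMem (by simpa [hn] using h),
      indicator_of_notMem (fun h' => h h'.1), smul_zero]

theorem tendsto_integral_annulus {a b d : ℝ} (ha : 0 < a) (hD : 0 < a * d - b ^ 2) (c e : ℝ)
    {u v : ℝ} (huv : u ≠ 0 ∨ v ≠ 0) :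
    Tendsto (fun p : ℝ × ℝ => ∫ z in {z : EuclideanSpace ℝ (Fin 2) | p.1 ≤ ‖z‖ ∧ ‖z‖ ≤ p.2},
        (((c * z 0 + e * z 1) *
          (a * z 0 ^ 2 + 2 * b * z 0 * z 1 + d * z 1 ^ 2) ^ (-(3 : ℝ) / 2) : ℝ) : ℂ) *
          Complex.exp (-Complex.I * ((z 0 * u + z 1 * v : ℝ) : ℂ)))
      (𝓝[>] 0 ×ˢ atTop)
      (𝓝 (-Complex.I * ((2 * Real.pi * (c * (d * u - b * v) + e * (a * v - b * u)) /
        ((a * d - b ^ 2) * √(d * u ^ 2 - 2 * b * u * v + a * v ^ 2)) : ℝ) : ℂ))) := by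
  obtain ⟨ρ, φ, hρ, hu, hv⟩ : ∃ ρ φ : ℝ, 0 < ρ ∧ u = ρ * Real.cos φ ∧ v = ρ * Real.sin φ := by
    have h0 : (⟨u, v⟩ : ℂ) ≠ 0 := fun h => by
      have h1 := congrArg Complex.re h
      have h2 := congrArg Complex.im h
      simp only [Complex.zero_re, Complex.zero_im] at h1 h2
      exact huv.elim (· h1) (· h2)
    exact ⟨‖(⟨u, v⟩ : ℂ)‖, Complex.arg ⟨u, v⟩, norm_pos_iff.2 h0,
      (Complex.norm_mul_cos_arg ⟨u, v⟩).symm, (Complex.norm_mul_sin_arg ⟨u, v⟩).symm⟩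
  have hK := continuous_angularKernel ha hD c e
  have hKa := antiperiodic_angularKernel a b d c e
  set s : ℝ → ℝ := fun t => Real.cos t * u + Real.sin t * v with hs_def
  have hs : Continuous s := by fun_prop
  have hsa : Function.Antiperiodic s Real.pi := fun t => by
    simp only [hs_def, Real.cos_add_pi, Real.sin_add_pi]
    ring
  have hsign : ∀ t, SignType.sign (s t) = SignType.sign (Real.cos (t - φ)) := fun t => by
    rw [show s t = ρ * Real.cos (t - φ) by rw [Real.cos_sub, hs_def, hu, hv]; ring, sign_mul,
      sign_pos hρ, one_mul]
  have hlim : ∫ t in -Real.pi..Real.pi,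
      angularKernel a b d c e t * (Real.pi / 2 * SignType.sign (s t)) =
      2 * Real.pi * (c * (d * u - b * v) + e * (a * v - b * u)) /
        ((a * d - b ^ 2) * √(d * u ^ 2 - 2 * b * u * v + a * v ^ 2)) := by
    simp only [hsign, mul_left_comm _ (Real.pi / 2)]
    rw [intervalIntegral.integral_const_mul, integral_mul_sign_cos hK hKa,
      integral_angularKernel_half_circle ha hD c e φ hρ, hu, hv]
    ring
  have h := tendsto_integral_mul_sineIntegral_sub hK hs (-Real.pi) Real.pi
  rw [hlim] at h
  refine (((Complex.continuous_ofReal.tendsto _).comp h).const_mul (-Complex.I)).congr' ?_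
  have h1 : ∀ᶠ p : ℝ × ℝ in 𝓝[>] 0 ×ˢ atTop, (0 < p.1 ∧ p.1 ≤ 1) ∧ 1 ≤ p.2 := by
    have h2 : ∀ᶠ x : ℝ in 𝓝[>] 0, 0 < x ∧ x ≤ 1 :=
      eventually_mem_nhdsWithin.and (mem_nhdsWithin_of_mem_nhds (Iic_mem_nhds one_pos))
    exact h2.prod_mk (eventually_ge_atTop (1 : ℝ))
  filter_upwards [h1] with p hp
  rw [integral_annulus_polar ha hD c e u v hp.1.1]
  exact (integral_annulus_sector hK hs hKa hsa hp.1.1 (hp.1.2.trans hp.2)).symm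

/-- the principal-value Fourier transform of `z ↦ zⱼ ⟨z, Gz⟩^(-3/2)`:
the truncated integrals over annuli `ε ≤ |z| ≤ R` converge, as `ε → 0⁺, R → ∞`, to
`-2πi (G⁻¹ξ)ⱼ / (√(det G) ⟨ξ, G⁻¹ξ⟩^(1/2))`; in particular the symbol of the
surface Riesz transform `R_j^g`, i.e. `1/(2π)` times the limit, equals
`-i (G⁻¹ξ)ⱼ / (√(det G) ⟨ξ, G⁻¹ξ⟩^(1/2))`. -/
theorem statement7 (G : Matrix (Fin 2) (Fin 2) ℝ) (hG : G.PosDef)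
    (ξ : EuclideanSpace ℝ (Fin 2)) (hξ : ξ ≠ 0) (j : Fin 2) :
    Tendsto
      (fun p : ℝ × ℝ =>
        ∫ z in {z : EuclideanSpace ℝ (Fin 2) | p.1 ≤ ‖z‖ ∧ ‖z‖ ≤ p.2},
          ((z j * (∑ i : Fin 2, ∑ k : Fin 2, z i * G i k * z k) ^ (-(3:ℝ)/2) : ℝ) : ℂ)
            * Complex.exp (-Complex.I * ((∑ i : Fin 2, z i * ξ i : ℝ) : ℂ)))
      ((𝓝[>] (0:ℝ)) ×ˢ atTop)
      (𝓝 ((((-2 * Real.pi : ℝ) : ℂ) * Complex.I * ((G⁻¹.mulVec (fun i => ξ i) j : ℝ) : ℂ))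
        / (((Real.sqrt G.det * Real.sqrt (∑ i : Fin 2, ∑ k : Fin 2, ξ i * G⁻¹ i k * ξ k) : ℝ) : ℂ))))
    ∧ (1 / (2 * (Real.pi : ℂ)))
        * ((((-2 * Real.pi : ℝ) : ℂ) * Complex.I * ((G⁻¹.mulVec (fun i => ξ i) j : ℝ) : ℂ))
            / (((Real.sqrt G.det * Real.sqrt (∑ i : Fin 2, ∑ k : Fin 2, ξ i * G⁻¹ i k * ξ k) : ℝ) : ℂ)))
      = (-Complex.I) * ((G⁻¹.mulVec (fun i => ξ i) j : ℝ) : ℂ)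
          / (((Real.sqrt G.det * Real.sqrt (∑ i : Fin 2, ∑ k : Fin 2, ξ i * G⁻¹ i k * ξ k) : ℝ) : ℂ)) := by
  have hsym : G 1 0 = G 0 1 := by simpa using hG.isHermitian.apply 0 1
  have ha : 0 < G 0 0 := hG.diag_pos
  have hdet : G.det = G 0 0 * G 1 1 - G 0 1 ^ 2 := by rw [det_fin_two, hsym]; ring
  have hD : 0 < G 0 0 * G 1 1 - G 0 1 ^ 2 := hdet ▸ hG.det_pos
  have hξ' : ξ 0 ≠ 0 ∨ ξ 1 ≠ 0 := by
    by_contra! h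
    exact hξ (by ext i; fin_cases i <;> simp [h.1, h.2])
  have hinv : G⁻¹ = (G 0 0 * G 1 1 - G 0 1 ^ 2)⁻¹ • !![G 1 1, -G 0 1; -G 0 1, G 0 0] := by
    rw [inv_def, hdet, Ring.inverse_eq_inv', adjugate_fin_two, hsym]
  constructor
  · have h := tendsto_integral_annulus ha hD (if j = 0 then 1 else 0) (if j = 0 then 0 else 1) hξ'
    convert h using 2
    · refine integral_congr_ae (ae_of_all _ fun z => ?_)
      simp only [Fin.sum_univ_two]
      have hz : z j = (if j = 0 then 1 else 0) * z 0 + (if j = 0 then 0 else 1) * z 1 := by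
        fin_cases j <;> simp
      rw [hz, hsym]
      ring_nf
    · have hQ : ∑ i : Fin 2, ∑ k : Fin 2, ξ i * G⁻¹ i k * ξ k =
          (G 1 1 * ξ 0 ^ 2 - 2 * G 0 1 * ξ 0 * ξ 1 + G 0 0 * ξ 1 ^ 2) /
            (G 0 0 * G 1 1 - G 0 1 ^ 2) := by
        simp only [Fin.sum_univ_two, hinv, Matrix.smul_apply, smul_eq_mul, of_apply,
          cons_val_zero, cons_val_one]
        field_simp
        ring
      have hm : G⁻¹.mulVec (fun i => ξ i) j =
          ((if j = 0 then 1 else 0) * (G 1 1 * ξ 0 - G 0 1 * ξ 1) +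
            (if j = 0 then 0 else 1) * (G 0 0 * ξ 1 - G 0 1 * ξ 0)) /
            (G 0 0 * G 1 1 - G 0 1 ^ 2) := by
        rw [hinv]
        fin_cases j <;> simp [mulVec, dotProduct, Fin.sum_univ_two] <;> field_simp <;> ring
      rw [← Real.sqrt_mul hG.det_pos.le, hQ, hm, hdet, mul_div_cancel₀ _ hD.ne']
      have hpos : 0 < G 1 1 * ξ 0 ^ 2 - 2 * G 0 1 * ξ 0 * ξ 1 + G 0 0 * ξ 1 ^ 2 := by
        have := quadratic_form_pos ha hD (x := ξ 1) (y := -ξ 0) (by simpa using hξ'.symm)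
        linarith
      have h1 : ((√(G 1 1 * ξ 0 ^ 2 - 2 * G 0 1 * ξ 0 * ξ 1 + G 0 0 * ξ 1 ^ 2) : ℝ) : ℂ) ≠ 0 :=
        Complex.ofReal_ne_zero.2 (Real.sqrt_pos.2 hpos).ne'
      have h2 : ((G 0 0 * G 1 1 - G 0 1 ^ 2 : ℝ) : ℂ) ≠ 0 := Complex.ofReal_ne_zero.2 hD.ne'
      push_cast at h2 ⊢
      field_simp
  · have : (Real.pi : ℂ) ≠ 0 := by exact_mod_cast Real.pi_ne_zero
    push_cast
    field_simp
end

section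
/- Let H be a complex Hilbert space, let K : H → H be a bounded self-adjoint linear operator, and let k₀ > 0 be a real number. Assume that K³ − k₀²K is a compact operator. Then every point λ of the spectrum σ(K) with λ ∉ {0, k₀, −k₀} is an isolated point of σ(K) and is an eigenvalue of K whose eigenspace is finite dimensional; moreover every accumulation point of σ(K) belongs to {0, k₀, −k₀}. -/
open Filter
open scoped Topology

open Module.End

/-- If `T` is compact and `μ ≠ 0`, then a sequence of unit vectors that are approximate
eigenvectors of `T` for `μ` has a convergent subsequence. -/
theorem IsCompactOperator.exists_tendsto_subseq_of_approx_eigenvector {E : Type*}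
    [NormedAddCommGroup E] [NormedSpace ℂ E] {T : E →L[ℂ] E} (hT : IsCompactOperator T)
    {μ : ℂ} (hμ : μ ≠ 0) {x : ℕ → E} (hx : ∀ n, ‖x n‖ = 1)
    (hlim : Tendsto (fun n ↦ T (x n) - μ • x n) atTop (𝓝 0)) :
    ∃ y, ∃ φ : ℕ → ℕ, StrictMono φ ∧ Tendsto (x ∘ φ) atTop (𝓝 y) := by
  obtain ⟨C, hC, hTC⟩ := hT.image_closedBall_subset_compact 1
  obtain ⟨w, -, φ, hφ, hw⟩ :=
    hC.tendsto_subseq (x := fun n ↦ T (x n)) fun n ↦ hTC ⟨x n, by simp [hx], rfl⟩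
  refine ⟨μ⁻¹ • (w - 0), φ, hφ, ?_⟩
  refine ((hw.sub (hlim.comp hφ.tendsto_atTop)).const_smul μ⁻¹).congr fun n ↦ ?_
  simp [hμ]

section PolynomiallyCompact

variable {E : Type*} [NormedAddCommGroup E] [NormedSpace ℂ E] {K : E →L[ℂ] E} {c z : ℂ}

theorem cubic_factor_apply (K : E →L[ℂ] E) (c z : ℂ) (x : E) :
    (K ∘L K ∘L K - c ^ 2 • K) x - (z ^ 3 - c ^ 2 * z) • x =
      (K ∘L K + z • K + (z ^ 2 - c ^ 2) • ContinuousLinearMap.id ℂ E) (K x - z • x) := by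
  simp only [sub_apply, add_apply,
    ContinuousLinearMap.comp_apply, smul_apply,
    ContinuousLinearMap.id_apply, map_sub, map_smul]
  module

theorem cubic_ne_zero (hz : z ∉ ({0, c, -c} : Set ℂ)) : z ^ 3 - c ^ 2 * z ≠ 0 := by
  simp only [Set.mem_insert_iff, Set.mem_singleton_iff, not_or] at hz
  have : z ^ 3 - c ^ 2 * z = z * (z - c) * (z + c) := by ring
  rw [this]
  exact mul_ne_zero (mul_ne_zero hz.1 (sub_ne_zero.2 hz.2.1))
    fun h ↦ hz.2.2 (eq_neg_of_add_eq_zero_left h)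

/-- If `K³ - c²K` is compact and `z ∉ {0, c, -c}`, a sequence of unit approximate eigenvectors
of `K` for `z` subconverges to a unit eigenvector. -/
theorem exists_eigenvector_tendsto_subseq (hcpt : IsCompactOperator (K ∘L K ∘L K - c ^ 2 • K))
    (hz : z ∉ ({0, c, -c} : Set ℂ)) {x : ℕ → E} (hx : ∀ n, ‖x n‖ = 1)
    (hlim : Tendsto (fun n ↦ K (x n) - z • x n) atTop (𝓝 0)) :
    ∃ y, ‖y‖ = 1 ∧ K y = z • y ∧
      ∃ φ : ℕ → ℕ, StrictMono φ ∧ Tendsto (x ∘ φ) atTop (𝓝 y) := by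
  obtain ⟨y, φ, hφ, hy⟩ := hcpt.exists_tendsto_subseq_of_approx_eigenvector (cubic_ne_zero hz) hx
    (by
      simp only [cubic_factor_apply]
      exact (ContinuousLinearMap.continuous _).tendsto' _ _ (map_zero _) |>.comp hlim)
  refine ⟨y, ?_, ?_, φ, hφ, hy⟩
  · exact tendsto_nhds_unique hy.norm (by simp [hx])
  · have h₁ : Tendsto (fun n ↦ K (x (φ n)) - z • x (φ n)) atTop (𝓝 (K y - z • y)) :=
      ((K.continuous.tendsto y).comp hy).sub (hy.const_smul z)
    exact sub_eq_zero.1 (tendsto_nhds_unique h₁ (hlim.comp hφ.tendsto_atTop))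

end PolynomiallyCompact

section SelfAdjoint

variable {H : Type*} [NormedAddCommGroup H] [InnerProductSpace ℂ H] [CompleteSpace H]
  {K : H →L[ℂ] H} {z : ℂ}

/-- Weyl's criterion: a spectral point of a self-adjoint operator is an approximate eigenvalue. -/
theorem IsSelfAdjoint.exists_approx_eigenvector (hK : IsSelfAdjoint K) (hz : z ∈ spectrum ℂ K) :
    ∃ x : ℕ → H, (∀ n, ‖x n‖ = 1) ∧ Tendsto (fun n ↦ K (x n) - z • x n) atTop (𝓝 0) := by
  have hS : IsSelfAdjoint (K - z • (1 : H →L[ℂ] H)) := by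
    refine hK.sub (IsSelfAdjoint.smul ?_ (IsSelfAdjoint.one _))
    rw [hK.mem_spectrum_eq_re hz]
    exact Complex.conj_ofReal _
  have hnot : ¬ ∃ C, AntilipschitzWith C (K - z • (1 : H →L[ℂ] H)) := by
    rintro ⟨C, hC⟩
    refine hz ?_
    rw [spectrum.mem_resolventSet_iff, ← IsUnit.neg_iff, neg_sub, Algebra.algebraMap_eq_smul_one,
      ContinuousLinearMap.isUnit_iff_bijective,
      ContinuousLinearMap.bijective_iff_dense_range_and_antilipschitz]
    refine ⟨?_, C, hC⟩
    rw [Submodule.topologicalClosure_eq_top_iff, ContinuousLinearMap.orthogonal_range,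
      ← ContinuousLinearMap.star_eq_adjoint, hS.star_eq]
    exact LinearMap.ker_eq_bot.2 hC.injective
  rw [antilipschitzWith_iff_exists_mul_le_norm] at hnot
  push Not at hnot
  have hunit (n : ℕ) : ∃ x : H, ‖x‖ = 1 ∧ ‖K x - z • x‖ ≤ 1 / ((n : ℝ) + 1) := by
    obtain ⟨x, hx⟩ := hnot (1 / ((n : ℝ) + 1)) (by positivity)
    have hx0 : x ≠ 0 := by
      rintro rfl
      simp at hx
    have hpos : 0 < ‖x‖ := norm_pos_iff.2 hx0
    refine ⟨((‖x‖⁻¹ : ℝ) : ℂ) • x, by simp [norm_smul, hpos.ne'], ?_⟩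
    have h : K (((‖x‖⁻¹ : ℝ) : ℂ) • x) - z • ((‖x‖⁻¹ : ℝ) : ℂ) • x =
        ((‖x‖⁻¹ : ℝ) : ℂ) • (K - z • (1 : H →L[ℂ] H)) x := by
      simp [smul_sub, smul_comm z]
    rw [h, norm_smul, Complex.norm_real, norm_inv, norm_norm, inv_mul_le_iff₀ hpos, mul_comm]
    exact hx.le
  choose x hx hxlim using hunit
  exact ⟨x, hx, squeeze_zero_norm hxlim tendsto_one_div_add_atTop_nhds_zero_nat⟩

variable {c : ℂ}

theorem IsSelfAdjoint.exists_unit_eigenvector_of_isCompactOperator_cubic (hK : IsSelfAdjoint K)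
    (hcpt : IsCompactOperator (K ∘L K ∘L K - c ^ 2 • K)) (hz : z ∈ spectrum ℂ K)
    (hzc : z ∉ ({0, c, -c} : Set ℂ)) : ∃ y, ‖y‖ = 1 ∧ K y = z • y := by
  obtain ⟨x, hx, hlim⟩ := hK.exists_approx_eigenvector hz
  obtain ⟨y, hy, hKy, -⟩ := exists_eigenvector_tendsto_subseq hcpt hzc hx hlim
  exact ⟨y, hy, hKy⟩

theorem IsSelfAdjoint.not_accPt_spectrum_of_isCompactOperator_cubic (hK : IsSelfAdjoint K)
    (hcpt : IsCompactOperator (K ∘L K ∘L K - c ^ 2 • K)) (hzc : z ∉ ({0, c, -c} : Set ℂ)) :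
    ¬ AccPt z (𝓟 (spectrum ℂ K)) := by
  intro hacc
  have hopen : ({0, c, -c} : Set ℂ)ᶜ ∈ 𝓝 z :=
    (Set.toFinite _).isClosed.isOpen_compl.mem_nhds hzc
  obtain ⟨l, hl, hmem⟩ := exists_seq_forall_of_frequently
    ((accPt_iff_frequently.1 hacc).and_eventually hopen)
  choose e he hKe using fun n ↦
    hK.exists_unit_eigenvector_of_isCompactOperator_cubic hcpt (hmem n).1.2 (hmem n).2
  have hlim : Tendsto (fun n ↦ K (e n) - z • e n) atTop (𝓝 0) := by
    rw [tendsto_zero_iff_norm_tendsto_zero]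
    refine (tendsto_iff_norm_sub_tendsto_zero.1 hl).congr fun n ↦ ?_
    rw [hKe, ← sub_smul, norm_smul, he, mul_one]
  obtain ⟨y, hy, hKy, φ, -, hφ⟩ := exists_eigenvector_tendsto_subseq hcpt hzc he hlim
  have horth (n : ℕ) : inner ℂ y (e (φ n)) = 0 :=
    hK.isSymmetric.orthogonalFamily_eigenspaces (hmem (φ n)).1.1.symm
      ⟨y, mem_eigenspace_iff.2 hKy⟩ ⟨e (φ n), mem_eigenspace_iff.2 (hKe _)⟩
  have hyy : inner ℂ y y = 0 :=
    tendsto_nhds_unique (tendsto_const_nhds.inner hφ) (by simp [horth])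
  rw [inner_self_eq_zero] at hyy
  simp [hyy] at hy

theorem finiteDimensional_eigenspace_of_isCompactOperator_cubic
    (hcpt : IsCompactOperator (K ∘L K ∘L K - c ^ 2 • K)) (hzc : z ∉ ({0, c, -c} : Set ℂ)) :
    FiniteDimensional ℂ (eigenspace (K : H →ₗ[ℂ] H) z) := by
  have := ContinuousLinearMap.finite_dimensional_eigenspace hcpt _ (cubic_ne_zero hzc)
  refine Submodule.finiteDimensional_of_le
    (S₂ := eigenspace (K ∘L K ∘L K - c ^ 2 • K).toLinearMap (z ^ 3 - c ^ 2 * z)) fun x hx ↦ ?_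
  have hx' : K x = z • x := mem_eigenspace_iff.1 hx
  refine mem_eigenspace_iff.2 (sub_eq_zero.1 ?_)
  exact (cubic_factor_apply K c z x).trans (by rw [hx', sub_self, map_zero])

end SelfAdjoint

/-- spectral consequence of polynomial compactness: if `K` is
self-adjoint and `K³ - k₀²K` is compact, then every spectral point outside
`{0, k₀, -k₀}` is an isolated eigenvalue of finite multiplicity, and every
accumulation point of the spectrum lies in `{0, k₀, -k₀}`. -/
theorem statement11 {H : Type*} [NormedAddCommGroup H] [InnerProductSpace ℂ H]
    [CompleteSpace H]
    (K : H →L[ℂ] H) (hK : IsSelfAdjoint K) (k₀ : ℝ) (hk₀ : 0 < k₀)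
    (hcpt : IsCompactOperator (⇑(K ∘L K ∘L K - ((k₀ : ℂ)^2) • K))) :
    (∀ lam ∈ spectrum ℂ K, lam ∉ ({0, (k₀ : ℂ), -(k₀ : ℂ)} : Set ℂ) →
        ¬ AccPt lam (𝓟 (spectrum ℂ K)) ∧
        Module.End.HasEigenvalue (↑K : H →ₗ[ℂ] H) lam ∧
        FiniteDimensional ℂ (Module.End.eigenspace (↑K : H →ₗ[ℂ] H) lam)) ∧
    (∀ z : ℂ, AccPt z (𝓟 (spectrum ℂ K)) → z ∈ ({0, (k₀ : ℂ), -(k₀ : ℂ)} : Set ℂ)) := by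
  refine ⟨fun lam hlam hne ↦
    ⟨hK.not_accPt_spectrum_of_isCompactOperator_cubic hcpt hne, ?_,
      finiteDimensional_eigenspace_of_isCompactOperator_cubic hcpt hne⟩, fun z hacc ↦ ?_⟩
  · obtain ⟨y, hy, hKy⟩ :=
      hK.exists_unit_eigenvector_of_isCompactOperator_cubic hcpt hlam hne
    exact hasEigenvalue_of_hasEigenvector
      ⟨mem_eigenspace_iff.2 hKy, fun h ↦ by simp [h] at hy⟩
  · by_contra hne
    exact hK.not_accPt_spectrum_of_isCompactOperator_cubic hcpt hne hacc
end

section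
/- Let H be a complex Hilbert space, let K : H → H be a bounded self-adjoint linear operator, and let k₀ > 0 be a real number. Assume that K³ − k₀²K is a compact operator but K² − k₀²I is not compact. Then there exists an orthonormal sequence (xₙ) in H such that ‖K xₙ‖ → 0 as n → ∞. -/
open Filter
open scoped Topology

theorem IsCompactOperator.of_isClosedEmbedding_comp {X Y Z : Type*} [Zero X] [TopologicalSpace X]
    [TopologicalSpace Y] [TopologicalSpace Z] {f : X → Y} {g : Y → Z}
    (hg : Topology.IsClosedEmbedding g) (h : IsCompactOperator (g ∘ f)) : IsCompactOperator f := by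
  obtain ⟨C, hC, hmem⟩ := h
  exact ⟨g ⁻¹' C, hg.isCompact_preimage hC, hmem⟩

section

variable {𝕜 H G : Type*} [RCLike 𝕜] [NormedAddCommGroup H] [InnerProductSpace 𝕜 H]
  [NormedAddCommGroup G] [NormedSpace 𝕜 G]

/-- If `K ∘ A` is compact and `A` is not, then `K` is not bounded below on the orthogonal
complement of any finite-dimensional subspace. -/
theorem exists_unit_mem_orthogonal_norm_lt [CompleteSpace H] {E : Type*} [NormedAddCommGroup E]
    [NormedSpace 𝕜 E] {K : H →L[𝕜] G} {A : E →L[𝕜] H} (hKA : IsCompactOperator (K ∘L A))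
    (hA : ¬ IsCompactOperator A) (F : Submodule 𝕜 H) [FiniteDimensional 𝕜 F]
    {ε : ℝ} (hε : 0 < ε) : ∃ x ∈ Fᗮ, ‖x‖ = 1 ∧ ‖K x‖ < ε := by
  by_contra! hbelow
  apply hA
  have : ProperSpace F := FiniteDimensional.proper 𝕜 F
  have hQ : IsCompactOperator (F.subtypeL ∘L F.orthogonalProjectionOnto ∘L A) :=
    (isCompactOperator_of_locallyCompactSpace_dom (F.orthogonalProjectionOnto ∘L A)).clm_comp
      F.subtypeL
  have hdecomp (u : E) :
      (Fᗮ.orthogonalProjectionOnto (A u) : H) = A u - F.orthogonalProjectionOnto (A u) :=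
    F.starProjection_orthogonal_val (A u)
  have hanti : AntilipschitzWith (Real.toNNReal ε⁻¹) (K ∘L Fᗮ.subtypeL) := by
    refine ContinuousLinearMap.antilipschitz_of_bound _ fun x => ?_
    rw [Real.coe_toNNReal _ (inv_nonneg.2 hε.le), inv_mul_eq_div, le_div_iff₀ hε]
    rcases eq_or_ne (x : H) 0 with hx | hx
    · simp [(Submodule.coe_eq_zero.1 hx : x = 0)]
    have h := hbelow (((‖(x : H)‖⁻¹ : ℝ) : 𝕜) • (x : H)) (Fᗮ.smul_mem _ x.2)
      (by simp [norm_smul, hx])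
    rw [map_smul, norm_smul, RCLike.norm_ofReal, abs_of_nonneg (by positivity),
      inv_mul_eq_div, le_div_iff₀ (norm_pos_iff.2 hx)] at h
    simpa [mul_comm] using h
  have hP : IsCompactOperator (Fᗮ.orthogonalProjectionOnto ∘L A) := by
    refine .of_isClosedEmbedding_comp
      (hanti.isClosedEmbedding (K ∘L Fᗮ.subtypeL).uniformContinuous) ?_
    convert hKA.sub (hQ.clm_comp K) using 1
    · rfl
    · funext u
      simp [hdecomp]
  convert (hP.clm_comp Fᗮ.subtypeL).add hQ using 1
  · rfl
  · funext u
    simp [hdecomp]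

theorem exists_orthonormal_tendsto_norm_zero (K : H →L[𝕜] G)
    (h : ∀ F : Submodule 𝕜 H, FiniteDimensional 𝕜 F → ∀ ε : ℝ, 0 < ε →
      ∃ x ∈ Fᗮ, ‖x‖ = 1 ∧ ‖K x‖ < ε) :
    ∃ x : ℕ → H, Orthonormal 𝕜 x ∧ Tendsto (fun n => ‖K (x n)‖) atTop (𝓝 0) := by
  obtain ⟨f, hf, hr⟩ := exists_seq_of_forall_finset_exists
    (fun p : ℕ × H => ‖p.2‖ = 1 ∧ ‖K p.2‖ < 1 / ((p.1 : ℝ) + 1))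
    (fun p q => p.1 < q.1 ∧ inner 𝕜 p.2 q.2 = 0) fun s _ => by
      classical
      obtain ⟨x, hxF, hx⟩ := h (Submodule.span 𝕜 (s.image Prod.snd : Finset H))
        (FiniteDimensional.span_finset 𝕜 _)
        (1 / (((s.sup Prod.fst + 1 : ℕ) : ℝ) + 1)) (by positivity)
      refine ⟨(s.sup Prod.fst + 1, x), hx, fun p hp => ⟨?_, ?_⟩⟩
      · exact Nat.lt_succ_of_le (Finset.le_sup (f := Prod.fst) hp)
      · exact (Submodule.mem_orthogonal _ _).1 hxF _
          (Submodule.subset_span (Finset.mem_coe.2 (Finset.mem_image_of_mem _ hp)))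
  have hmono : StrictMono fun n => (f n).1 := fun m n hmn => (hr m n hmn).1
  refine ⟨fun n => (f n).2, ⟨fun n => (hf n).1, fun m n hmn => ?_⟩, ?_⟩
  · rcases hmn.lt_or_gt with hlt | hgt
    · exact (hr m n hlt).2
    · exact inner_eq_zero_symm.1 (hr n m hgt).2
  · exact squeeze_zero (fun n => norm_nonneg _) (fun n => (hf n).2.le)
      ((tendsto_one_div_add_atTop_nhds_zero_nat (𝕜 := ℝ)).comp hmono.tendsto_atTop)

end

/-- if `K` is self-adjoint, `K³ - k₀²K` is compact but `K² - k₀²I`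
is not, then `0` lies in the essential spectrum of `K`: there is an orthonormal
(singular Weyl) sequence `(xₙ)` with `‖K xₙ‖ → 0`. -/
theorem statement12 {H : Type*} [NormedAddCommGroup H] [InnerProductSpace ℂ H]
    [CompleteSpace H]
    (K : H →L[ℂ] H) (hK : IsSelfAdjoint K) (k₀ : ℝ) (hk₀ : 0 < k₀)
    (hcpt : IsCompactOperator (⇑(K ∘L K ∘L K - ((k₀ : ℂ)^2) • K)))
    (hncpt : ¬ IsCompactOperator (⇑(K ∘L K - ((k₀ : ℂ)^2) • (1 : H →L[ℂ] H)))) :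
    ∃ x : ℕ → H, Orthonormal ℂ x ∧
      Tendsto (fun n => ‖K (x n)‖) atTop (𝓝 0) := by
  refine exists_orthonormal_tendsto_norm_zero K fun F _ ε hε =>
    exists_unit_mem_orthogonal_norm_lt (A := K ∘L K - ((k₀ : ℂ)^2) • (1 : H →L[ℂ] H)) ?_
      hncpt F hε
  convert hcpt using 2
  ext u
  simp
end

section
/- Let H be a complex Hilbert space, let K : H → H be a bounded self-adjoint linear operator, and let k₀ > 0 be a real number. Assume that K³ − k₀²K is a compact operator but K(K + k₀I) is not compact. Then there exists an orthonormal sequence (xₙ) in H such that ‖K xₙ − k₀ xₙ‖ → 0 as n → ∞. -/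
open Filter
open scoped Topology

/-- A bounded operator `T` is compact if `A T` is compact for some bounded operator `A` which is
bounded below on the orthogonal complement of a finite-dimensional subspace. -/
lemma isCompactOperator_of_comp_of_bounded_below {H : Type*} [NormedAddCommGroup H]
    [InnerProductSpace ℂ H] [CompleteSpace H] (A T : H →L[ℂ] H)
    (hAT : IsCompactOperator (A ∘L T)) (F : Submodule ℂ H) [FiniteDimensional ℂ F]
    {ε : ℝ} (hε : 0 < ε) (hA : ∀ x ∈ Fᗮ, ε * ‖x‖ ≤ ‖A x‖) :
    IsCompactOperator T := by
  have hF : IsCompactOperator F.starProjection := by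
    have : ProperSpace F := FiniteDimensional.proper ℂ F
    exact (isCompactOperator_of_locallyCompactSpace_dom F.orthogonalProjectionOnto).clm_comp
      F.subtypeL
  have hFT : IsCompactOperator (F.starProjection ∘L T) := hF.comp_clm T
  let Q : H →L[ℂ] Fᗮ := Fᗮ.orthogonalProjectionOnto
  let B : Fᗮ →L[ℂ] H := A ∘L Fᗮ.subtypeL
  have hQ : ∀ y, (Q y : H) = y - F.starProjection y := fun y ↦ by
    simp only [Q, Submodule.coe_orthogonalProjectionOnto_apply]
    exact Submodule.starProjection_orthogonal_val y
  have hBQT : IsCompactOperator (B ∘L Q ∘L T) := by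
    have h : B ∘L Q ∘L T = A ∘L T - A ∘L F.starProjection ∘L T := by
      ext y
      simp [B, hQ]
    rw [h]
    exact hAT.sub (hFT.clm_comp A)
  have hB : AntilipschitzWith (Real.toNNReal ε⁻¹) B := by
    refine B.antilipschitz_of_bound fun x ↦ ?_
    rw [Real.coe_toNNReal _ (inv_nonneg.2 hε.le), ← div_eq_inv_mul, le_div_iff₀' hε]
    exact hA x x.2
  have hQT : IsCompactOperator (Q ∘L T) := by
    obtain ⟨M, hM, hMT⟩ := hBQT
    exact ⟨B ⁻¹' M, (hB.isClosedEmbedding B.uniformContinuous).isCompact_preimage hM, hMT⟩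
  have h : T = Fᗮ.subtypeL ∘L Q ∘L T + F.starProjection ∘L T := by
    ext y
    simp [hQ]
  rw [h]
  exact (hQT.clm_comp Fᗮ.subtypeL).add hFT

/-- An operator which is not bounded below on the orthogonal complement of any finite-dimensional
subspace has a singular sequence at `0`. -/
lemma exists_orthonormal_tendsto_zero {H : Type*} [NormedAddCommGroup H]
    [InnerProductSpace ℂ H] (A : H →L[ℂ] H)
    (hA : ∀ (F : Submodule ℂ H) [FiniteDimensional ℂ F] (ε : ℝ), 0 < ε →
      ∃ x ∈ Fᗮ, ‖A x‖ < ε * ‖x‖) :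
    ∃ x : ℕ → H, Orthonormal ℂ x ∧ Tendsto (fun n ↦ ‖A (x n)‖) atTop (𝓝 0) := by
  obtain ⟨f, hf, hfr⟩ := exists_seq_of_forall_finset_exists
    (fun p : ℕ × H ↦ ‖p.2‖ = 1 ∧ ‖A p.2‖ ≤ 1 / ((p.1 : ℝ) + 1))
    (fun p q ↦ p.1 < q.1 ∧ inner ℂ p.2 q.2 = 0) fun s _ ↦ by
      classical
      let n := s.sup Prod.fst + 1
      obtain ⟨x, hx, hAx⟩ := hA (Submodule.span ℂ (s.image Prod.snd : Set H))
        (1 / ((n : ℝ) + 1)) Nat.one_div_pos_of_nat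
      have hx0 : 0 < ‖x‖ := by
        refine norm_pos_iff.2 fun h ↦ ?_
        simp [h] at hAx
      refine ⟨(n, ((‖x‖⁻¹ : ℝ) : ℂ) • x), ⟨?_, ?_⟩, fun p hp ↦ ⟨?_, ?_⟩⟩
      · simp [norm_smul, hx0.ne']
      · rw [map_smul, norm_smul, Complex.norm_real, norm_inv, norm_norm, inv_mul_le_iff₀ hx0,
          mul_comm]
        exact hAx.le
      · exact Nat.lt_succ_of_le (Finset.le_sup (f := Prod.fst) hp)
      · rw [inner_smul_right, (Submodule.mem_orthogonal _ x).1 hx p.2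
          (Submodule.subset_span (Finset.mem_coe.2 (Finset.mem_image_of_mem _ hp))), mul_zero]
  have hmono : StrictMono fun n ↦ (f n).1 := fun m n h ↦ (hfr m n h).1
  refine ⟨fun n ↦ (f n).2, ⟨fun n ↦ (hf n).1, fun m n hmn ↦ ?_⟩, ?_⟩
  · rcases hmn.lt_or_gt with h | h
    · exact (hfr m n h).2
    · exact inner_eq_zero_symm.1 (hfr n m h).2
  · exact squeeze_zero (fun _ ↦ norm_nonneg _) (fun n ↦ (hf n).2)
      (tendsto_one_div_add_atTop_nhds_zero_nat.comp hmono.tendsto_atTop)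

/-- if `K` is self-adjoint, `K³ - k₀²K` is compact but `K(K + k₀I)`
is not, then `k₀` lies in the essential spectrum of `K`: there is an orthonormal
(singular Weyl) sequence `(xₙ)` with `‖K xₙ - k₀ xₙ‖ → 0`. -/
theorem statement13 {H : Type*} [NormedAddCommGroup H] [InnerProductSpace ℂ H]
    [CompleteSpace H]
    (K : H →L[ℂ] H) (hK : IsSelfAdjoint K) (k₀ : ℝ) (hk₀ : 0 < k₀)
    (hcpt : IsCompactOperator (⇑(K ∘L K ∘L K - ((k₀ : ℂ)^2) • K)))
    (hncpt : ¬ IsCompactOperator (⇑(K ∘L (K + (k₀ : ℂ) • (1 : H →L[ℂ] H))))) :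
    ∃ x : ℕ → H, Orthonormal ℂ x ∧
      Tendsto (fun n => ‖K (x n) - (k₀ : ℂ) • x n‖) atTop (𝓝 0) := by
  refine exists_orthonormal_tendsto_zero (K - (k₀ : ℂ) • (1 : H →L[ℂ] H)) fun F _ ε hε ↦ ?_
  by_contra! h
  refine hncpt (isCompactOperator_of_comp_of_bounded_below _ _ ?_ F hε h)
  convert hcpt using 2
  ext y
  simp only [ContinuousLinearMap.comp_apply, sub_apply, add_apply, smul_apply,
    one_apply_eq_self, map_add, map_smul]
  module
end

section
/- Let H be a complex Hilbert space, let K : H → H be a bounded self-adjoint linear operator, and let k₀ > 0 be a real number. Assume that K³ − k₀²K is compact, while none of the three operators K(K − k₀I), K(K + k₀I), K² − k₀²I is compact. Then: (i) every point λ of the spectrum σ(K) with λ ∉ {0, k₀, −k₀} is an isolated point of σ(K) and an eigenvalue of K with finite-dimensional eigenspace; and (ii) for each c ∈ {0, k₀, −k₀} there exists a sequence (λₙ) of eigenvalues of K with λₙ → c. In particular, σ(K) consists of three non-empty sequences of eigenvalues converging to 0, k₀ and −k₀, together with their limit points. -/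
open Filter
open scoped Topology

theorem ContinuousLinearMap.not_accPt_spectrum_of_isCompactOperator {H : Type*}
    [NormedAddCommGroup H] [InnerProductSpace ℂ H] [CompleteSpace H] {T : H →L[ℂ] H}
    (hT : IsSelfAdjoint T) (hc : IsCompactOperator T) {ν : ℂ} (hν : ν ≠ 0) :
    ¬ AccPt ν (𝓟 (spectrum ℂ T)) := by
  intro hacc
  have hδ : 0 < ‖ν‖ / 2 := by positivity
  have hinf := Set.Infinite.of_accPt (hacc.nhds_inter (Metric.ball_mem_nhds ν hδ))
  let s := hinf.natEmbedding
  have hs_norm (n : ℕ) : ‖ν‖ / 2 ≤ ‖(s n : ℂ)‖ := by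
    have h1 : ‖(s n : ℂ) - ν‖ < ‖ν‖ / 2 := by simpa [dist_eq_norm] using (s n).2.1
    have h2 := norm_sub_norm_le ν (s n : ℂ)
    rw [norm_sub_rev] at h2
    linarith
  have hs_eig (n : ℕ) : ∃ v : H, ‖v‖ = 1 ∧ T v = (s n : ℂ) • v := by
    have h0 : (s n : ℂ) ≠ 0 := norm_pos_iff.1 (hδ.trans_le (hs_norm n))
    obtain ⟨v, hv⟩ := ((hc.hasEigenvalue_iff_mem_spectrum h0).2 (s n).2.2).exists_hasEigenvector
    refine ⟨((‖v‖ : ℂ)⁻¹) • v, ?_, ?_⟩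
    · simp [norm_smul, hv.2]
    · have hTv : T v = (s n : ℂ) • v := hv.apply_eq_smul
      rw [map_smul, hTv, smul_comm]
  choose v hv_norm hv using hs_eig
  have hv_orth (m n : ℕ) (hmn : m ≠ n) : inner ℂ (v m) (v n) = 0 :=
    hT.isSymmetric.orthogonalFamily_eigenspaces
      (fun h => hmn (s.injective (Subtype.ext h)) : (s m : ℂ) ≠ s n)
      ⟨v m, Module.End.mem_eigenspace_iff.2 (hv m)⟩ ⟨v n, Module.End.mem_eigenspace_iff.2 (hv n)⟩
  have hsep (m n : ℕ) (hmn : m ≠ n) : ‖ν‖ / 2 ≤ dist (T (v m)) (T (v n)) := by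
    have horth : inner ℂ (T (v m)) (T (v n)) = 0 := by
      simp [hv, hv_orth m n hmn]
    have hpyth := norm_sub_sq (𝕜 := ℂ) (T (v m)) (T (v n))
    rw [horth, map_zero] at hpyth
    have hTm : ‖ν‖ / 2 ≤ ‖T (v m)‖ := by simpa [hv, norm_smul, hv_norm] using hs_norm m
    rw [dist_eq_norm]
    nlinarith [norm_nonneg (T (v m) - T (v n)), norm_nonneg (T (v n))]
  obtain ⟨C, hC, hTC⟩ := IsCompactOperator.image_subset_compact_of_bounded
    (f := (T : H →ₗ[ℂ] H)) hc (Metric.isBounded_closedBall (x := (0 : H)) (r := 1))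
  obtain ⟨_, -, φ, hφ, hlim⟩ := hC.tendsto_subseq (x := fun n => T (v n))
    fun n => hTC ⟨v n, by simp [hv_norm], rfl⟩
  obtain ⟨N, hN⟩ := Metric.cauchySeq_iff'.1 hlim.cauchySeq _ hδ
  exact (hN (N + 1) N.le_succ).not_ge (hsep _ _ (hφ N.lt_succ_self).ne')

theorem ContinuousLinearMap.hasEigenvalue_of_not_accPt_spectrum {H : Type*}
    [NormedAddCommGroup H] [InnerProductSpace ℂ H] [CompleteSpace H] {K : H →L[ℂ] H}
    (hK : IsStarNormal K) {c : ℂ} (hc : c ∈ spectrum ℂ K)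
    (hacc : ¬ AccPt c (𝓟 (spectrum ℂ K))) :
    Module.End.HasEigenvalue (K : H →ₗ[ℂ] H) c := by
  classical
  let f : ℂ → ℂ := fun z => if z = c then 1 else 0
  have hf : ContinuousOn f (spectrum ℂ K) := by
    intro x _
    by_cases hx : x = c
    · exact hx ▸ continuousWithinAt_of_not_accPt hacc
    · refine (continuousAt_const (y := (0 : ℂ))).congr ?_ |>.continuousWithinAt
      filter_upwards [isOpen_ne.mem_nhds hx] with y hy
      simp [f, hy]
  have hne : cfc f K ≠ 0 := by
    intro h0
    have hmem : f c ∈ spectrum ℂ (cfc f K) := by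
      rw [cfc_map_spectrum f K]
      exact Set.mem_image_of_mem f hc
    have : Nontrivial (H →L[ℂ] H) := by
      by_contra hn
      rw [not_nontrivial_iff_subsingleton] at hn
      simp at hmem
    simp [h0, f] at hmem
  have hmul : (K - algebraMap ℂ _ c) * cfc f K = 0 := by
    have h1 : cfc (fun z => z - c) K = K - algebraMap ℂ _ c := by
      rw [cfc_sub (fun z => z) (fun _ => c) K, cfc_id' ℂ K, cfc_const c K]
    rw [← h1, ← cfc_mul (fun z => z - c) f K, ← cfc_zero ℂ K]
    refine cfc_congr fun z _ => ?_
    by_cases hz : z = c <;> simp [f, hz]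
  obtain ⟨v, hv⟩ : ∃ v, cfc f K v ≠ 0 := by
    by_contra! h
    exact hne (ContinuousLinearMap.ext h)
  refine Module.End.hasEigenvalue_of_hasEigenvector (x := cfc f K v)
    ⟨Module.End.mem_eigenspace_iff.2 ?_, hv⟩
  have := congrArg (fun A : H →L[ℂ] H => A v) hmul
  simpa [sub_eq_zero, Algebra.algebraMap_eq_smul_one] using this

theorem IsCompactOperator.of_isUnit_mul {𝕜 E : Type*} [NontriviallyNormedField 𝕜]
    [NormedAddCommGroup E] [NormedSpace 𝕜 E] {A B : E →L[𝕜] E} (hA : IsUnit A)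
    (h : IsCompactOperator (⇑(A * B))) : IsCompactOperator (⇑B) := by
  obtain ⟨u, rfl⟩ := hA
  have hB : B = (↑u⁻¹ : E →L[𝕜] E) * (↑u * B) := by simp
  rw [hB]
  exact h.clm_comp (↑u⁻¹ : E →L[𝕜] E)

theorem mem_spectrum_of_isCompactOperator_mul {𝕜 E : Type*} [NontriviallyNormedField 𝕜]
    [NormedAddCommGroup E] [NormedSpace 𝕜 E] {K B : E →L[𝕜] E} {c : 𝕜}
    (h : IsCompactOperator (⇑((K - c • (1 : E →L[𝕜] E)) * B)))
    (hB : ¬ IsCompactOperator (⇑B)) : c ∈ spectrum 𝕜 K := by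
  by_contra hc
  rw [spectrum.notMem_iff, IsUnit.sub_iff, Algebra.algebraMap_eq_smul_one] at hc
  exact hB (.of_isUnit_mul hc h)

/-- abstract form of the main spectral theorem. If `K` is
self-adjoint, `K³ - k₀²K` is compact, and none of `K(K - k₀I)`, `K(K + k₀I)`,
`K² - k₀²I` is compact, then (i) every spectral point outside `{0, k₀, -k₀}` is
an isolated eigenvalue of finite multiplicity, and (ii) for each
`c ∈ {0, k₀, -k₀}` there is a sequence of eigenvalues of `K` converging to `c`. -/
theorem statement15 {H : Type*} [NormedAddCommGroup H] [InnerProductSpace ℂ H]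
    [CompleteSpace H]
    (K : H →L[ℂ] H) (hK : IsSelfAdjoint K) (k₀ : ℝ) (hk₀ : 0 < k₀)
    (hcpt : IsCompactOperator (⇑(K ∘L K ∘L K - ((k₀ : ℂ)^2) • K)))
    (hn1 : ¬ IsCompactOperator (⇑(K ∘L (K - (k₀ : ℂ) • (1 : H →L[ℂ] H)))))
    (hn2 : ¬ IsCompactOperator (⇑(K ∘L (K + (k₀ : ℂ) • (1 : H →L[ℂ] H)))))
    (hn3 : ¬ IsCompactOperator (⇑(K ∘L K - ((k₀ : ℂ)^2) • (1 : H →L[ℂ] H)))) :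
    (∀ lam ∈ spectrum ℂ K, lam ∉ ({0, (k₀ : ℂ), -(k₀ : ℂ)} : Set ℂ) →
        ¬ AccPt lam (𝓟 (spectrum ℂ K)) ∧
        Module.End.HasEigenvalue (↑K : H →ₗ[ℂ] H) lam ∧
        FiniteDimensional ℂ (Module.End.eigenspace (↑K : H →ₗ[ℂ] H) lam)) ∧
    (∀ c ∈ ({0, (k₀ : ℂ), -(k₀ : ℂ)} : Set ℂ), ∃ lamseq : ℕ → ℂ,
        (∀ n : ℕ, Module.End.HasEigenvalue (↑K : H →ₗ[ℂ] H) (lamseq n)) ∧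
        Tendsto lamseq atTop (𝓝 c)) := by
  set T : H →L[ℂ] H := K ∘L K ∘L K - ((k₀ : ℂ) ^ 2) • K with hT
  have hKn : IsStarNormal K := hK.isStarNormal
  have hTsa : IsSelfAdjoint T := by
    refine IsSelfAdjoint.sub ?_ (IsSelfAdjoint.smul ?_ hK)
    · have : K ∘L K ∘L K = K ^ 3 := by ext; simp [pow_succ]
      exact this ▸ hK.pow 3
    · simp [isSelfAdjoint_iff]
  let p : Polynomial ℂ := .X ^ 3 - .C ((k₀ : ℂ) ^ 2) * .X
  have hpT : Polynomial.aeval K p = T := by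
    ext x
    simp [p, hT, pow_succ, Algebra.algebraMap_eq_smul_one]
    module
  have hp (z : ℂ) : p.eval z = z * (z - k₀) * (z + k₀) := by
    simp only [p, Polynomial.eval_sub, Polynomial.eval_pow, Polynomial.eval_X,
      Polynomial.eval_mul, Polynomial.eval_C]
    ring
  have isolated_eigenvalue (z : ℂ) (hz : z ∈ spectrum ℂ K)
      (hz' : z ∉ ({0, (k₀ : ℂ), -(k₀ : ℂ)} : Set ℂ)) :
      ¬ AccPt z (𝓟 (spectrum ℂ K)) ∧
        Module.End.HasEigenvalue (↑K : H →ₗ[ℂ] H) z ∧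
        FiniteDimensional ℂ (Module.End.eigenspace (↑K : H →ₗ[ℂ] H) z) := by
    simp only [Set.mem_insert_iff, Set.mem_singleton_iff, not_or] at hz'
    have hpz : p.eval z ≠ 0 := by
      rw [hp]
      exact mul_ne_zero (mul_ne_zero hz'.1 (sub_ne_zero.2 hz'.2.1))
        (fun h => hz'.2.2 (eq_neg_of_add_eq_zero_left h))
    have hacc : ¬ AccPt z (𝓟 (spectrum ℂ K)) := by
      intro hacc
      refine ContinuousLinearMap.not_accPt_spectrum_of_isCompactOperator hTsa hcpt hpz ?_
      have hq : p - .C (p.eval z) ≠ 0 := by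
        intro h
        have h0 := congrArg (Polynomial.eval 0) h
        rw [Polynomial.eval_sub, Polynomial.eval_C, hp 0] at h0
        exact hpz (by simpa using h0)
      have hroots := (p - .C (p.eval z)).roots.toFinset.finite_toSet.subset
        (Set.sdiff_subset (t := {z}))
      rw [accPt_iff_nhds] at hacc ⊢
      intro U hU
      obtain ⟨y, ⟨⟨hyU, hyr⟩, hyK⟩, hyz⟩ := hacc _ (inter_mem
        (p.continuous.continuousAt.preimage_mem_nhds hU)
        (hroots.isClosed.isOpen_compl.mem_nhds (by simp)))
      refine ⟨p.eval y, ⟨hyU, ?_⟩, fun h => hyr ⟨?_, hyz⟩⟩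
      · rw [← hpT]
        exact spectrum.subset_polynomial_aeval K p ⟨y, hyK, rfl⟩
      · simp [hq, h]
    refine ⟨hacc, ContinuousLinearMap.hasEigenvalue_of_not_accPt_spectrum hKn hz hacc, ?_⟩
    have := ContinuousLinearMap.finite_dimensional_eigenspace hcpt _ hpz
    refine Submodule.finiteDimensional_of_le
      (S₂ := Module.End.eigenspace (T : H →ₗ[ℂ] H) (p.eval z)) fun x hx => ?_
    have hx : K x = z • x := Module.End.mem_eigenspace_iff.1 hx
    refine Module.End.mem_eigenspace_iff.2 ?_
    simp only [hT, ContinuousLinearMap.coe_coe, sub_apply,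
      ContinuousLinearMap.comp_apply, smul_apply, hx, map_smul, hp]
    module
  refine ⟨isolated_eigenvalue, fun c hc => ?_⟩
  have hcK : c ∈ spectrum ℂ K := by
    rcases hc with rfl | rfl | rfl
    · refine mem_spectrum_of_isCompactOperator_mul ?_ hn3
      convert hcpt using 2
      ext x
      simp [hT]
    · refine mem_spectrum_of_isCompactOperator_mul ?_ hn2
      convert hcpt using 2
      ext x
      simp [hT]
      module
    · refine mem_spectrum_of_isCompactOperator_mul ?_ hn1
      convert hcpt using 2
      ext x
      simp [hT]
      module
  by_cases hacc : AccPt c (𝓟 (spectrum ℂ K))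
  · have hex (n : ℕ) : ∃ y, Module.End.HasEigenvalue (↑K : H →ₗ[ℂ] H) y ∧
        dist y c < 1 / ((n : ℝ) + 1) := by
      have hfin : (({0, (k₀ : ℂ), -(k₀ : ℂ)} : Set ℂ) \ {c}).Finite := Set.toFinite _
      obtain ⟨y, ⟨⟨hyb, hyr⟩, hyK⟩, hyc⟩ := accPt_iff_nhds.1 hacc _ (inter_mem
        (Metric.ball_mem_nhds c (Nat.one_div_pos_of_nat (α := ℝ) (n := n)))
        (hfin.isClosed.isOpen_compl.mem_nhds (by simp)))
      exact ⟨y, (isolated_eigenvalue y hyK fun h => hyr ⟨h, hyc⟩).2.1, hyb⟩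
    choose y hy hyd using hex
    exact ⟨y, hy, tendsto_iff_dist_tendsto_zero.2 (squeeze_zero (fun _ => dist_nonneg)
      (fun n => (hyd n).le) tendsto_one_div_add_atTop_nhds_zero_nat)⟩
  · exact ⟨fun _ => c,
      fun _ => ContinuousLinearMap.hasEigenvalue_of_not_accPt_spectrum hKn hcK hacc,
      tendsto_const_nhds⟩
end
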